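/- Fix p ∈ [1,2) and set r_p := 2p/(2+p). The sequence (W^{(n,p)})_{n∈ℕ} satisfies a large deviation principle with speed n^{r_p} and rate function 𝕀ᵃ_p(w) := |w|^{r_p}/r_p; moreover this rate function is quasiconvex, symmetric, and good. -/

import Mathlib

open MeasureTheory Filter Topology Set ProbabilityTheory
open scoped ENNReal NNReal

noncomputable section

namespace LDP

/-- The nonnegative part of an extended real, as an extended nonnegative real. -/
def erealToENNReal (x : EReal) : ℝ≥0∞ := if x = ⊤ then ⊤ else ENNReal.ofReal x.toReal

/-- Extended (possibly infinite) integral of an `EReal`-valued function: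
positive part minus negative part. -/
def eIntegral (ν : Measure ℝ) (f : ℝ → EReal) : EReal :=
  ((∫⁻ u, erealToENNReal (f u) ∂ν : ℝ≥0∞) : EReal)
    - ((∫⁻ u, erealToENNReal (-f u) ∂ν : ℝ≥0∞) : EReal)

/-- `q`-th absolute moment of a measure on `ℝ`. -/
def mom (q : ℝ) (ν : Measure ℝ) : ℝ≥0∞ := ∫⁻ x, ENNReal.ofReal (|x| ^ q) ∂ν

open Classical in
/-- Relative entropy `H(ν|μ)`. -/
def relEnt (ν μ : Measure ℝ) : EReal :=
  if ν ≪ μ then eIntegral ν (fun x => ENNReal.log (ν.rnDeriv μ x)) else ⊤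

/-- The generalized normal distribution `μ_p` on `ℝ`. -/
def muP (p : ℝ) : Measure ℝ :=
  volume.withDensity fun y =>
    ENNReal.ofReal ((2 * p ^ (1/p) * Real.Gamma (1 + 1/p))⁻¹ * Real.exp (-(|y| ^ p) / p))

/-- The uniform probability measure `μ_∞` on `[-1,1]`. -/
def muInf : Measure ℝ := (volume (Icc (-1:ℝ) 1))⁻¹ • volume.restrict (Icc (-1:ℝ) 1)

/-- Extended-real-valued log moment generating function of a measure on `ℝ`. -/
def logM (γ : Measure ℝ) (t : ℝ) : EReal :=
  ENNReal.log (∫⁻ y, ENNReal.ofReal (Real.exp (t * y)) ∂γ)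

/-- The class `𝒯_q` of measures whose log mgf is dominated by `C|t|^{q/(q-1)} + C`. -/
def memT (q : ℝ) (γ : Measure ℝ) : Prop :=
  ∃ C : ℝ, ∀ t : ℝ, logM γ t ≤ ((C * |t| ^ (q/(q-1)) + C : ℝ) : EReal)

/-- Legendre transform of a function of one real variable. -/
def legendre1 (Λ : ℝ → EReal) (τ : ℝ) : EReal := ⨆ t : ℝ, ((t * τ : ℝ) : EReal) - Λ t

/-- Legendre transform of a function of two real variables. -/
def legendre2 (Λ : ℝ × ℝ → EReal) (τ : ℝ × ℝ) : EReal :=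
  ⨆ t : ℝ × ℝ, ((t.1 * τ.1 + t.2 * τ.2 : ℝ) : EReal) - Λ t

/-- Legendre transform of a function of three real variables. -/
def legendre3 (Λ : ℝ × ℝ × ℝ → EReal) (τ : ℝ × ℝ × ℝ) : EReal :=
  ⨆ t : ℝ × ℝ × ℝ, ((t.1 * τ.1 + t.2.1 * τ.2.1 + t.2.2 * τ.2.2 : ℝ) : EReal) - Λ t

/-- `Φ_p(t₀,t₁,t₂) = log ∫∫ exp(t₀ z² + t₁ z y + t₂ |y|^p) μ₂(dz) μ_p(dy)`. -/
def Phi (p : ℝ) (t : ℝ × ℝ × ℝ) : EReal :=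
  ENNReal.log (∫⁻ y, (∫⁻ z,
    ENNReal.ofReal (Real.exp (t.1 * z^2 + t.2.1 * z * y + t.2.2 * |y| ^ p)) ∂(muP 2)) ∂(muP p))

/-- The annealed rate function `𝕀ᵃ_p` for `p ∈ [2,∞)`. -/
def Ia (p : ℝ) (w : ℝ) : EReal :=
  ⨅ τ ∈ {τ : ℝ × ℝ × ℝ | 0 < τ.1 ∧ 0 < τ.2.2 ∧
      τ.1 ^ (-(1:ℝ)/2) * τ.2.1 * τ.2.2 ^ (-(1:ℝ)/p) = w},
    legendre3 (Phi p) τ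

/-- `Λ_p(t₁,t₂) = log ∫ exp(t₁ y + t₂|y|^p) μ_p(dy)`. -/
def LamP (p : ℝ) (t : ℝ × ℝ) : EReal :=
  ENNReal.log (∫⁻ y, ENNReal.ofReal (Real.exp (t.1 * y + t.2 * |y| ^ p)) ∂(muP p))

/-- `Ψ_{p,ν}(t₁,t₂) = ∫ Λ_p(t₁ u, t₂) ν(du)`. -/
def Psi (p : ℝ) (ν : Measure ℝ) (t : ℝ × ℝ) : EReal :=
  eIntegral ν (fun u => LamP p (t.1 * u, t.2))

/-- The quenched rate function `𝕀^q_{p,ν}`. -/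
def Iq (p : ℝ) (ν : Measure ℝ) (w : ℝ) : EReal :=
  ⨅ τ ∈ {τ : ℝ × ℝ | 0 < τ.2 ∧ τ.1 * τ.2 ^ (-(1:ℝ)/p) = w}, legendre2 (Psi p ν) τ

/-- The Cramér-type rate function `𝕀^{cr}_p`. -/
def Icr (p : ℝ) (w : ℝ) : EReal :=
  ⨅ τ ∈ {τ : ℝ × ℝ | 0 < τ.2 ∧ τ.1 * τ.2 ^ (-(1:ℝ)/p) = w}, legendre2 (LamP p) τ

/-- `Φ_γ(t₀,t₁) = log ∫∫ exp(t₀ z² + t₁ z x) μ₂(dz) γ(dx)`. -/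
def Phig (γ : Measure ℝ) (t : ℝ × ℝ) : EReal :=
  ENNReal.log (∫⁻ x, (∫⁻ z,
    ENNReal.ofReal (Real.exp (t.1 * z^2 + t.2 * z * x)) ∂(muP 2)) ∂γ)

/-- The annealed rate function `𝕀ᵃ_γ` for a product measure `γ^{⊗n}`. -/
def Iag (γ : Measure ℝ) (w : ℝ) : EReal :=
  ⨅ τ ∈ {τ : ℝ × ℝ | 0 < τ.1 ∧ τ.1 ^ (-(1:ℝ)/2) * τ.2 = w}, legendre2 (Phig γ) τ

/-- `Ψ_{γ,ν}(t) = ∫ log M_γ(t u) ν(du)`. -/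
def Psig (γ ν : Measure ℝ) (t : ℝ) : EReal := eIntegral ν (fun u => logM γ (t * u))

/-- The quenched rate function `𝕀^q_{γ,ν}` for a product measure. -/
def Iqg (γ ν : Measure ℝ) : ℝ → EReal := legendre1 (Psig γ ν)

/-- `Ψ_{∞,ν}`. -/
def PsiInf (ν : Measure ℝ) : ℝ → EReal := Psig muInf ν

/-- `𝕀^q_{∞,ν}`. -/
def IqInf (ν : Measure ℝ) : ℝ → EReal := legendre1 (PsiInf ν)

/-- `𝕀ᵃ_∞`. -/
def IaInf : ℝ → EReal := Iag muInf

/-- Euclidean inner product on `ℝⁿ`. -/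
def dotp {n : ℕ} (x y : Fin n → ℝ) : ℝ := ∑ i, x i * y i

/-- The unit ℓ^p ball of `ℝⁿ`. -/
def lpBall (n : ℕ) (p : ℝ) : Set (Fin n → ℝ) := {x | ∑ i, |x i| ^ p ≤ 1}

/-- The uniform probability measure on the unit ℓ^p ball. -/
def uniformLpBall (n : ℕ) (p : ℝ) : Measure (Fin n → ℝ) :=
  (volume (lpBall n p))⁻¹ • volume.restrict (lpBall n p)

/-- The unit Euclidean sphere in `ℝⁿ`. -/
def unitSphereSet (n : ℕ) : Set (Fin n → ℝ) := {x | ∑ i, (x i)^2 = 1}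

/-- `μ` is the (unique) rotation-invariant probability measure on the unit sphere `S^{n-1}`. -/
def IsUniformSphere {n : ℕ} (μ : Measure (Fin n → ℝ)) : Prop :=
  IsProbabilityMeasure μ ∧ μ (unitSphereSet n) = 1 ∧
    ∀ O : Matrix.orthogonalGroup (Fin n) ℝ,
      Measure.map (fun x => (O : Matrix (Fin n) (Fin n) ℝ).mulVec x) μ = μ

/-- A large deviation principle with speed `s` and rate function `I`. -/
def IsLDP {Ω : Type*} [MeasurableSpace Ω] (P : Measure Ω)
    (ξ : ℕ → Ω → ℝ) (s : ℕ → ℝ) (I : ℝ → EReal) : Prop :=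
  LowerSemicontinuous I ∧
    ∀ Γ : Set ℝ, MeasurableSet Γ →
      (-(⨅ x ∈ interior Γ, I x) ≤
        atTop.liminf fun n =>
          (((s n)⁻¹ : ℝ) : EReal) * ENNReal.log (P {ω | ξ n ω ∈ interior Γ})) ∧
      ((atTop.limsup fun n =>
          (((s n)⁻¹ : ℝ) : EReal) * ENNReal.log (P {ω | ξ n ω ∈ closure Γ})) ≤
        -(⨅ x ∈ closure Γ, I x))

/-- Goodness of a rate function: compact sublevel sets. -/
def HasCompactSublevels (I : ℝ → EReal) : Prop := ∀ c : ℝ, IsCompact {x | I x ≤ (c : EReal)}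

/-- Quasiconvexity: convex sublevel sets. -/
def QuasiconvexRate (I : ℝ → EReal) : Prop := ∀ c : EReal, Convex ℝ {x | I x ≤ c}

/-- Symmetry: `I(-w) = I(w)`. -/
def SymmetricRate (I : ℝ → EReal) : Prop := ∀ w : ℝ, I (-w) = I w

/-- Convexity of an extended-real-valued rate function. -/
def ConvexRate (I : ℝ → EReal) : Prop :=
  ∀ x y a b : ℝ, 0 ≤ a → 0 ≤ b → a + b = 1 →
    I (a * x + b * y) ≤ (a : EReal) * I x + (b : EReal) * I y

/-- Convexity on a set, for extended-real-valued functions. -/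
def ConvexOnE (s : Set ℝ) (g : ℝ → EReal) : Prop :=
  ∀ x ∈ s, ∀ y ∈ s, ∀ a b : ℝ, 0 ≤ a → 0 ≤ b → a + b = 1 →
    g (a * x + b * y) ≤ (a : EReal) * g x + (b : EReal) * g y

/-- Concavity on a set, for extended-real-valued functions. -/
def ConcaveOnE (s : Set ℝ) (g : ℝ → EReal) : Prop :=
  ∀ x ∈ s, ∀ y ∈ s, ∀ a b : ℝ, 0 ≤ a → 0 ≤ b → a + b = 1 →
    (a : EReal) * g x + (b : EReal) * g y ≤ g (a * x + b * y)

/-- Strict convexity, for extended-real-valued functions. -/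
def StrictConvexE (g : ℝ → EReal) : Prop :=
  ∀ x y : ℝ, x ≠ y → ∀ a b : ℝ, 0 < a → 0 < b → a + b = 1 →
    g (a * x + b * y) < (a : EReal) * g x + (b : EReal) * g y

/-- The property of agreeing with a real affine function on a set. -/
def AffineOnE (s : Set ℝ) (g : ℝ → EReal) : Prop :=
  ∃ m q : ℝ, ∀ t ∈ s, g t = ((m * t + q : ℝ) : EReal)

/-- Empirical measure `L_{n,θ} = (1/n) Σ δ_{√n θ_i}`. -/
def empMeas (n : ℕ) (θn : Fin n → ℝ) : Measure ℝ :=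
  ((n : ℝ≥0∞))⁻¹ • ∑ i : Fin n, Measure.dirac (Real.sqrt n * θn i)

end LDP

open LDP

/-- Tonelli for products of functions of separate coordinates. -/
lemma lintegral_pi_prod_eq {E : Type*} [MeasurableSpace E] (n : ℕ) (μ : Fin n → Measure E)
    [∀ i, SigmaFinite (μ i)] (f : Fin n → E → ℝ≥0∞) (hf : ∀ i, Measurable (f i)) :
    ∫⁻ x, ∏ i, f i (x i) ∂(Measure.pi μ) = ∏ i, ∫⁻ x, f i x ∂(μ i) := by
  induction n with
  | zero => simp
  | succ n ih =>
    have h := (measurePreserving_piFinSuccAbove μ 0).symm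
    rw [← h.lintegral_comp_emb (MeasurableEquiv.measurableEmbedding _)]
    simp only [Fin.prod_univ_succ, MeasurableEquiv.piFinSuccAbove_symm_apply, Fin.insertNthEquiv,
      Fin.insertNth_zero, Equiv.coe_fn_mk, Fin.cons_zero, Fin.cons_succ, Fin.zero_succAbove,
      cast_eq]
    rw [lintegral_prod_mul (f := f 0) (g := fun y : Fin n → E => ∏ i, f i.succ (y i)),
      ih _ _ (fun i => hf i.succ)]
    · exact (hf 0).aemeasurable
    · exact (Finset.measurable_prod _ fun i _ => (hf i.succ).comp (measurable_pi_apply i)).aemeasurable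

lemma pi_withDensity_eq (n : ℕ) (d : ℝ → ℝ≥0∞) (hd : Measurable d)
    [SigmaFinite ((volume : Measure ℝ).withDensity d)] :
    Measure.pi (fun _ : Fin n => (volume : Measure ℝ).withDensity d)
      = (volume : Measure (Fin n → ℝ)).withDensity (fun y => ∏ i, d (y i)) := by
  refine Measure.pi_eq fun s hs => ?_
  rw [withDensity_apply _ (MeasurableSet.univ_pi hs), ← lintegral_indicator (MeasurableSet.univ_pi hs)]
  simp_rw [withDensity_apply _ (hs _), ← lintegral_indicator (hs _)]
  rw [volume_pi, ← lintegral_pi_prod_eq n (fun _ => volume) (fun i => (s i).indicator d)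
    (fun i => hd.indicator (hs i))]
  congr 1
  ext y
  by_cases hy : y ∈ univ.pi s
  · rw [indicator_of_mem hy]
    exact Finset.prod_congr rfl fun i _ => (indicator_of_mem (hy i (mem_univ i)) _).symm
  · rw [indicator_of_notMem hy]
    simp only [Set.mem_pi, mem_univ, true_imp_iff, not_forall] at hy
    obtain ⟨i, hi⟩ := hy
    exact (Finset.prod_eq_zero (Finset.mem_univ i) (indicator_of_notMem hi _)).symm

lemma integrable_exp_neg_mul_abs_rpow {q b s : ℝ} (hq : 0 < q) (hb : 0 < b) (hs : -1 < s) :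
    Integrable (fun y : ℝ => |y| ^ s * Real.exp (-b * |y| ^ q)) := by
  have h := integrableOn_rpow_mul_exp_neg_mul_rpow hs hq hb
  have h1 : IntegrableOn (fun y : ℝ => |y| ^ s * Real.exp (-b * |y| ^ q)) (Ioi 0) := by
    refine h.congr_fun (fun x hx => ?_) measurableSet_Ioi
    simp only [abs_of_pos (mem_Ioi.1 hx)]
  have h2 : IntegrableOn (fun y : ℝ => |y| ^ s * Real.exp (-b * |y| ^ q)) (Iic 0) := by
    rw [← Measure.map_neg_eq_self (volume : Measure ℝ)]
    let m : MeasurableEmbedding fun x : ℝ => -x := (Homeomorph.neg ℝ).measurableEmbedding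
    rw [m.integrableOn_map_iff]
    simp_rw [Function.comp_def, abs_neg, neg_preimage, neg_Iic, neg_zero]
    exact (integrableOn_Ici_iff_integrableOn_Ioi enorm_ne_top).2 h1
  rw [← integrableOn_univ, ← Iic_union_Ioi (a := (0 : ℝ))]
  exact h2.union h1

lemma lintegral_exp_neg_mul_abs_rpow {q b : ℝ} (hq : 0 < q) (hb : 0 < b) :
    ∫⁻ y : ℝ, ENNReal.ofReal (Real.exp (-b * |y| ^ q))
      = ENNReal.ofReal (2 * (b ^ (-1 / q) * Real.Gamma (1 / q + 1))) := by
  have hi := integrable_exp_neg_mul_abs_rpow hq hb (s := 0) (by norm_num)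
  simp only [Real.rpow_zero, one_mul] at hi
  rw [← ofReal_integral_eq_lintegral_ofReal hi (ae_of_all _ fun _ => (Real.exp_pos _).le)]
  rw [integral_comp_abs (f := fun y => Real.exp (-b * y ^ q)), integral_exp_neg_mul_rpow hq hb]

/-- The normalising constant of `muP`. -/
def muPConst (q : ℝ) : ℝ := (2 * q ^ (1 / q) * Real.Gamma (1 + 1 / q))⁻¹

lemma muPConst_pos {q : ℝ} (hq : 0 < q) : 0 < muPConst q := by
  have := Real.Gamma_pos_of_pos (s := 1 + 1 / q) (by positivity)
  unfold muPConst; positivity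

lemma measurable_muPDensity (q : ℝ) :
    Measurable fun y : ℝ => ENNReal.ofReal (muPConst q * Real.exp (-(|y| ^ q) / q)) := by
  fun_prop

lemma muP_eq (q : ℝ) : muP q = volume.withDensity
    fun y : ℝ => ENNReal.ofReal (muPConst q * Real.exp (-(|y| ^ q) / q)) := rfl

lemma lintegral_muP (q : ℝ) {f : ℝ → ℝ≥0∞} (hf : Measurable f) :
    ∫⁻ y, f y ∂(muP q)
      = ∫⁻ y, ENNReal.ofReal (muPConst q * Real.exp (-(|y| ^ q) / q)) * f y := by
  rw [muP_eq, lintegral_withDensity_eq_lintegral_mul _ (measurable_muPDensity q) hf]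
  rfl

lemma lintegral_exp_mul_abs_rpow_muP {q l : ℝ} (hq : 0 < q) (hl : q * l < 1) :
    ∫⁻ y, ENNReal.ofReal (Real.exp (l * |y| ^ q)) ∂(muP q)
      = ENNReal.ofReal ((1 - q * l) ^ (-1 / q)) := by
  have hb : 0 < 1 / q - l := by
    rw [sub_pos, lt_div_iff₀ hq]; linarith
  have hc := (muPConst_pos hq)
  have hG := Real.Gamma_pos_of_pos (s := 1 + 1 / q) (by positivity)
  rw [lintegral_muP q (by fun_prop)]
  have : ∀ y : ℝ, ENNReal.ofReal (muPConst q * Real.exp (-(|y| ^ q) / q)) *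
      ENNReal.ofReal (Real.exp (l * |y| ^ q))
      = ENNReal.ofReal (muPConst q) * ENNReal.ofReal (Real.exp (-(1 / q - l) * |y| ^ q)) := by
    intro y
    rw [← ENNReal.ofReal_mul (by positivity), ← ENNReal.ofReal_mul hc.le, mul_assoc,
      ← Real.exp_add]
    congr 3; field_simp; ring
  simp_rw [this]
  rw [lintegral_const_mul _ (by fun_prop), lintegral_exp_neg_mul_abs_rpow hq hb,
    ← ENNReal.ofReal_mul hc.le]
  congr 1
  have e : 1 / q - l = (1 - q * l) * q⁻¹ := by field_simp
  rw [e, Real.mul_rpow (by linarith) (by positivity), Real.inv_rpow hq.le, ← Real.rpow_neg hq.le,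
    muPConst, add_comm (1 / q) 1, show -(-1 / q) = 1 / q by ring]
  have := Real.rpow_pos_of_pos hq (1 / q)
  field_simp

lemma isProbabilityMeasure_muP {q : ℝ} (hq : 0 < q) : IsProbabilityMeasure (muP q) := by
  constructor
  have := lintegral_exp_mul_abs_rpow_muP (l := 0) hq (by simp)
  simpa using this

lemma map_neg_muP (q : ℝ) : (muP q).map (fun y => -y) = muP q := by
  ext s hs
  rw [Measure.map_apply measurable_neg hs]
  unfold muP
  rw [withDensity_apply _ (measurable_neg hs), withDensity_apply _ hs,
    ← lintegral_indicator (measurable_neg hs), ← lintegral_indicator hs,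
    ← lintegral_neg_eq_self]
  congr 1; ext y
  by_cases h : y ∈ s <;> simp [indicator, h]

lemma gaussianReal_eq_muP : gaussianReal 0 1 = muP 2 := by
  rw [gaussianReal_of_var_ne_zero _ one_ne_zero]
  unfold muP gaussianPDF gaussianPDFReal
  congr 1; ext y
  congr 2
  · have : Real.Gamma (1 + 1 / 2) = Real.sqrt Real.pi / 2 := by
      rw [add_comm, Real.Gamma_add_one (by norm_num), Real.Gamma_one_half_eq]; ring
    rw [this, ← Real.sqrt_eq_rpow, NNReal.coe_one, mul_one, Real.sqrt_mul (by norm_num)]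
    congr 1; ring
  · simp

/-- Lower bound for the tail of the generalized normal distribution. -/
lemma le_muP_Ici {q a : ℝ} (hq : 0 < q) (ha : 0 ≤ a) :
    ENNReal.ofReal (muPConst q * Real.exp (-((a + 1) ^ q) / q)) ≤ muP q (Ici a) := by
  calc ENNReal.ofReal (muPConst q * Real.exp (-((a + 1) ^ q) / q))
      = ∫⁻ y in Icc a (a + 1), ENNReal.ofReal (muPConst q * Real.exp (-((a + 1) ^ q) / q)) := by
        simp
    _ ≤ ∫⁻ y in Icc a (a + 1), ENNReal.ofReal (muPConst q * Real.exp (-(|y| ^ q) / q)) := by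
        refine setLIntegral_mono (measurable_muPDensity q) fun y hy => ?_
        have hc := (muPConst_pos hq).le
        gcongr
        rw [abs_of_nonneg (ha.trans hy.1)]
        · exact hy.2
    _ = muP q (Icc a (a + 1)) := by
        unfold muP; rw [withDensity_apply _ measurableSet_Icc]; rfl
    _ ≤ muP q (Ici a) := measure_mono Icc_subset_Ici_self

lemma lintegral_moment_muP_lt_top {q e : ℝ} (hq : 0 < q) (he : 0 < e) (s : ℝ) (hs : 0 ≤ s) :
    ∫⁻ y, ENNReal.ofReal (|y| ^ s * Real.exp ((1 - e) * (|y| ^ q / q))) ∂(muP q) < ⊤ := by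
  have hc := (muPConst_pos hq)
  rw [lintegral_muP q (by fun_prop)]
  have : ∀ y : ℝ, ENNReal.ofReal (muPConst q * Real.exp (-(|y| ^ q) / q)) *
      ENNReal.ofReal (|y| ^ s * Real.exp ((1 - e) * (|y| ^ q / q)))
      = ENNReal.ofReal (muPConst q) * ENNReal.ofReal (|y| ^ s * Real.exp (-(e / q) * |y| ^ q)) := by
    intro y
    rw [← ENNReal.ofReal_mul (by positivity), ← ENNReal.ofReal_mul hc.le, mul_assoc,
      mul_left_comm (Real.exp _), ← Real.exp_add,
      show -(|y| ^ q) / q + (1 - e) * (|y| ^ q / q) = -(e / q) * |y| ^ q by ring, mul_left_comm]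
  simp_rw [this]
  rw [lintegral_const_mul _ (by fun_prop)]
  refine ENNReal.mul_lt_top ENNReal.ofReal_lt_top ?_
  exact (integrable_exp_neg_mul_abs_rpow hq (by positivity : 0 < e / q) (by linarith)).lintegral_lt_top

lemma exists_orthogonal_mulVec_eq {n : ℕ} {v w : Fin n → ℝ}
    (h : ∑ i, v i ^ 2 = ∑ i, w i ^ 2) :
    ∃ O : Matrix.orthogonalGroup (Fin n) ℝ, (O : Matrix (Fin n) (Fin n) ℝ).mulVec v = w := by
  classical
  by_cases hvw : v = w
  · exact ⟨1, by simp [hvw]⟩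
  set u := v - w with hu
  have hvv : v ⬝ᵥ v = w ⬝ᵥ w := by
    simpa [dotProduct, pow_two] using h
  have huu : u ⬝ᵥ u = 2 * (u ⬝ᵥ v) := by
    simp only [hu, sub_dotProduct, dotProduct_sub, hvv, dotProduct_comm v w]; ring
  have hu0 : u ⬝ᵥ u ≠ 0 := by
    rw [Ne, dotProduct_self_eq_zero, hu, sub_eq_zero]; exact hvw
  let H : Matrix (Fin n) (Fin n) ℝ := 1 - (2 / (u ⬝ᵥ u)) • Matrix.vecMulVec u u
  have hT : H.transpose = H := by
    simp [H, Matrix.transpose_sub, Matrix.transpose_vecMulVec]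
  have hHH : H * H = 1 := by
    have e : Matrix.vecMulVec u u * Matrix.vecMulVec u u = (u ⬝ᵥ u) • Matrix.vecMulVec u u := by
      rw [Matrix.vecMulVec_mul_vecMulVec]
      ext i j; simp [Matrix.vecMulVec_apply]; ring
    simp only [H, sub_mul, mul_sub, one_mul, mul_one, smul_mul_assoc, mul_smul_comm, e, smul_sub,
      smul_smul]
    have : 2 / (u ⬝ᵥ u) * (2 / (u ⬝ᵥ u) * (u ⬝ᵥ u)) = 2 * (2 / (u ⬝ᵥ u)) := by
      field_simp
    rw [this, two_mul, add_smul]; abel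
  refine ⟨⟨H, (Matrix.mem_orthogonalGroup_iff (Fin n) ℝ).2 ?_⟩, ?_⟩
  · change H * H.transpose = 1
    rw [hT, hHH]
  · simp only [H, Matrix.sub_mulVec, Matrix.one_mulVec, Matrix.smul_mulVec, Matrix.vecMulVec_mulVec]
    ext i
    have : u ⬝ᵥ v ≠ 0 := by intro h0; rw [huu, h0] at hu0; simp at hu0
    simp only [Pi.sub_apply, Pi.smul_apply, smul_eq_mul, huu, MulOpposite.smul_eq_mul_unop,
      MulOpposite.unop_op]
    field_simp
    simp [hu]

lemma dotp_comm {n : ℕ} (x y : Fin n → ℝ) : dotp x y = dotp y x := dotProduct_comm x y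

@[fun_prop]
lemma Measurable.dotp {α : Type*} [MeasurableSpace α] {n : ℕ} {f g : α → Fin n → ℝ}
    (hf : Measurable f) (hg : Measurable g) : Measurable fun a => dotp (f a) (g a) := by
  unfold LDP.dotp; fun_prop

lemma dotp_smul_left {n : ℕ} (c : ℝ) (x y : Fin n → ℝ) : dotp (c • x) y = c * dotp x y :=
  smul_dotProduct c x y

lemma measure_le_dotp_congr {n : ℕ} {μ : Measure (Fin n → ℝ)}
    (hμ : IsUniformSphere μ) {v w : Fin n → ℝ} (h : ∑ i, v i ^ 2 = ∑ i, w i ^ 2) (u : ℝ) :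
    μ {θ | u ≤ dotp v θ} = μ {θ | u ≤ dotp w θ} := by
  obtain ⟨O, hO⟩ := exists_orthogonal_mulVec_eq h
  conv_rhs => rw [← hμ.2.2 O]
  rw [Measure.map_apply (by fun_prop) (measurableSet_le measurable_const (by fun_prop))]
  congr 1; ext θ
  have : dotp w ((O : Matrix (Fin n) (Fin n) ℝ).mulVec θ) = dotp v θ := by
    change w ⬝ᵥ _ = v ⬝ᵥ θ
    rw [← hO, Matrix.dotProduct_mulVec, ← Matrix.mulVec_transpose, Matrix.mulVec_mulVec]
    rw [(Matrix.mem_orthogonalGroup_iff' (Fin n) ℝ).1 O.2, Matrix.one_mulVec]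
  simp [this]

/-- The standard Gaussian measure on `Fin n → ℝ`. -/
abbrev gaussPi (n : ℕ) : Measure (Fin n → ℝ) := Measure.pi fun _ => muP 2

instance : IsProbabilityMeasure (muP 2) := isProbabilityMeasure_muP two_pos

lemma gaussPi_le_dotp_congr {n : ℕ} {v w : Fin n → ℝ} (h : ∑ i, v i ^ 2 = ∑ i, w i ^ 2) (u : ℝ) :
    gaussPi n {g | u ≤ dotp v g} = gaussPi n {g | u ≤ dotp w g} := by
  have key : ∀ v : Fin n → ℝ, gaussPi n {g | u ≤ dotp v g}
      = stdGaussian (EuclideanSpace ℝ (Fin n)) {x | u ≤ inner ℝ (WithLp.toLp 2 v) x} := by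
    intro v
    rw [← map_pi_eq_stdGaussian, gaussianReal_eq_muP, Measure.map_apply (by fun_prop)
      (measurableSet_le measurable_const (by fun_prop))]
    congr 1; ext g
    simp only [mem_ofPred_eq, mem_preimage, EuclideanSpace.inner_toLp_toLp, star_trivial]
    rw [dotProduct_comm]; rfl
  have hn : ‖WithLp.toLp 2 v‖ = ‖WithLp.toLp 2 w‖ := by
    simp [EuclideanSpace.norm_eq, h]
  let f := (ℝ ∙ (WithLp.toLp 2 v - WithLp.toLp 2 w))ᗮ.reflection
  have hf : f (WithLp.toLp 2 v) = WithLp.toLp 2 w := Submodule.reflection_sub hn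
  rw [key, key]
  conv_rhs => rw [← stdGaussian_map f]
  rw [Measure.map_apply (by fun_prop) (measurableSet_le measurable_const (by fun_prop))]
  congr 1; ext x
  simp [← hf]

/-- The Euclidean norm on `Fin n → ℝ`. -/
def l2 {n : ℕ} (g : Fin n → ℝ) : ℝ := Real.sqrt (∑ i, g i ^ 2)

lemma measurable_l2 {n : ℕ} : Measurable (l2 : (Fin n → ℝ) → ℝ) := by
  unfold l2; fun_prop

lemma l2_sq {n : ℕ} (g : Fin n → ℝ) : l2 g ^ 2 = ∑ i, g i ^ 2 :=
  Real.sq_sqrt (Finset.sum_nonneg fun _ _ => sq_nonneg _)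

/-- The projection of a Gaussian vector is the product of its independent norm with the projection of
a uniform vector of the sphere. -/
lemma gaussPi_le_dotp_eq_lintegral {n : ℕ} {μ : Measure (Fin n → ℝ)} (hμ : IsUniformSphere μ)
    (y : Fin n → ℝ) (u : ℝ) :
    gaussPi n {g | u ≤ dotp y g} = ∫⁻ g, μ {θ | u ≤ l2 g * dotp y θ} ∂(gaussPi n) := by
  have := hμ.1
  have h1 : ∀ g : Fin n → ℝ, μ {θ | u ≤ l2 g * dotp y θ} = μ {θ | u ≤ l2 y * dotp g θ} := by
    intro g
    simp_rw [← dotp_smul_left]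
    refine measure_le_dotp_congr hμ ?_ u
    simp only [Pi.smul_apply, smul_eq_mul, mul_pow, ← Finset.mul_sum, ← l2_sq]
    ring
  have hS : MeasurableSet {z : (Fin n → ℝ) × (Fin n → ℝ) | u ≤ l2 y * dotp z.1 z.2} :=
    measurableSet_le measurable_const (by fun_prop)
  have h2 : ∀ᵐ θ ∂μ, gaussPi n {g | u ≤ l2 y * dotp g θ} = gaussPi n {g | u ≤ dotp y g} := by
    have hm : MeasurableSet (unitSphereSet n) :=
      measurableSet_eq_fun (by fun_prop) measurable_const
    filter_upwards [(mem_ae_iff_prob_eq_one hm).2 hμ.2.1] with θ hθ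
    simp_rw [dotp_comm _ θ, ← dotp_smul_left]
    refine gaussPi_le_dotp_congr ?_ u
    have hθ' : ∑ i, θ i ^ 2 = 1 := hθ
    simp only [Pi.smul_apply, smul_eq_mul, mul_pow, ← Finset.mul_sum, ← l2_sq y, hθ', mul_one]
  simp_rw [h1]
  have h3 : ∫⁻ g, μ {θ | u ≤ l2 y * dotp g θ} ∂(gaussPi n)
      = ((gaussPi n).prod μ) {z | u ≤ l2 y * dotp z.1 z.2} := by
    rw [Measure.prod_apply hS]; rfl
  rw [h3, Measure.prod_apply_symm hS]
  change _ = ∫⁻ θ, gaussPi n {g | u ≤ l2 y * dotp g θ} ∂μ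
  rw [lintegral_congr_ae h2]
  simp

lemma ofReal_exp_neg_div_eq_lintegral {p : ℝ} (hp : 0 < p) (t : ℝ) :
    ENNReal.ofReal (Real.exp (-t / p))
      = ∫⁻ s in Ioi t, ENNReal.ofReal (1 / p * Real.exp (-(1 / p * s))) := by
  have hneg : -(1 / p) < 0 := by simpa using hp
  have hi := integrableOn_exp_mul_Ioi hneg t
  have e : ∀ s : ℝ, 1 / p * Real.exp (-(1 / p * s)) = 1 / p * Real.exp (-(1 / p) * s) := by
    intro s; rw [neg_mul]
  simp_rw [e]
  rw [← ofReal_integral_eq_lintegral_ofReal (hi.const_mul _)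
    (ae_of_all _ fun _ => by positivity), integral_const_mul, integral_exp_mul_Ioi hneg]
  congr 1
  rw [show -(1 / p) * t = -t / p by ring]
  field_simp

/-- The product of generalized normal distributions is a scale mixture of uniform distributions on
`ℓ^p` balls. -/
lemma lintegral_pi_muP_eq_mixture {n : ℕ} {p : ℝ} (hp : 0 < p)
    [hU : IsProbabilityMeasure (uniformLpBall n p)] {φ : (Fin n → ℝ) → ℝ≥0∞} (hφ : Measurable φ) :
    ∫⁻ y, φ y ∂(Measure.pi fun _ : Fin n => muP p)
      = ∫⁻ s, ∫⁻ x, φ (s ^ (1 / p) • x) ∂(uniformLpBall n p) ∂(gammaMeasure (n / p + 1) (1 / p)) := by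
  have ha : (0 : ℝ) < n / p + 1 := by positivity
  have hr : 0 < 1 / p := by positivity
  have hprob : IsProbabilityMeasure (muP p) := isProbabilityMeasure_muP hp
  have hgprob := isProbabilityMeasure_gammaMeasure ha hr
  have hc := muPConst_pos hp
  let N : (Fin n → ℝ) → ℝ := fun y => ∑ i, |y i| ^ p
  have hN : Measurable N := by fun_prop
  have hN0 : ∀ y, 0 ≤ N y := fun y => Finset.sum_nonneg fun i _ => by positivity
  have hB : MeasurableSet (lpBall n p) := measurableSet_le hN measurable_const
  have hV0 : volume (lpBall n p) ≠ 0 ∧ volume (lpBall n p) ≠ ⊤ := by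
    have h := hU.measure_univ
    simp only [uniformLpBall, Measure.smul_apply, Measure.restrict_apply_univ, smul_eq_mul] at h
    constructor
    · intro h0; rw [h0] at h; simp at h
    · intro h0; rw [h0] at h; simp at h
  have hsc : ∀ (φ : (Fin n → ℝ) → ℝ≥0∞), Measurable φ → ∀ s : ℝ, 0 < s →
      ∫⁻ y, {y | N y ≤ s}.indicator φ y
        = ENNReal.ofReal (s ^ (n / p)) * volume (lpBall n p)
          * ∫⁻ x, φ (s ^ (1 / p) • x) ∂(uniformLpBall n p) := by
    intro φ hφ s hs
    have hρ : 0 < s ^ (1 / p) := by positivity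
    have h1 : ∫⁻ x, φ (s ^ (1 / p) • x) ∂(uniformLpBall n p)
        = (volume (lpBall n p))⁻¹ * ∫⁻ x, {y | N y ≤ s}.indicator φ (s ^ (1 / p) • x) := by
      rw [uniformLpBall, lintegral_smul_measure, ← lintegral_indicator hB, smul_eq_mul]
      congr 2; ext x
      have : N (s ^ (1 / p) • x) ≤ s ↔ x ∈ lpBall n p := by
        simp only [N, Pi.smul_apply, smul_eq_mul, abs_mul, abs_of_pos hρ, lpBall, mem_ofPred_eq]
        simp_rw [Real.mul_rpow hρ.le (abs_nonneg _), ← Finset.mul_sum]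
        rw [← Real.rpow_mul hs.le, one_div_mul_cancel hp.ne', Real.rpow_one]
        exact ⟨fun h => by nlinarith, fun h => by nlinarith⟩
      by_cases hx : x ∈ lpBall n p
      · rw [indicator_of_mem hx,
          indicator_of_mem (show s ^ (1 / p) • x ∈ {y | N y ≤ s} from this.2 hx)]
      · rw [indicator_of_notMem hx, indicator_of_notMem
          (show s ^ (1 / p) • x ∉ {y | N y ≤ s} from fun h => hx (this.1 h))]
    have hind : Measurable ({y | N y ≤ s}.indicator φ) :=
      hφ.indicator (measurableSet_le hN measurable_const)
    have h2 : ∫⁻ x, {y | N y ≤ s}.indicator φ (s ^ (1 / p) • x)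
        = ENNReal.ofReal (s ^ (n / p))⁻¹ * ∫⁻ y, {y | N y ≤ s}.indicator φ y := by
      rw [← lintegral_map (f := {y | N y ≤ s}.indicator φ) (g := fun x => s ^ (1 / p) • x) hind
        (by fun_prop), Measure.map_addHaar_smul _ hρ.ne', lintegral_smul_measure, smul_eq_mul]
      congr 2
      rw [Module.finrank_fin_fun, abs_of_pos (by positivity), ← Real.rpow_natCast,
        ← Real.rpow_mul hs.le]
      congr 2; ring
    have hs' : 0 < s ^ (n / p) := by positivity
    rw [h1, h2, ENNReal.ofReal_inv_of_pos hs']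
    have e0 : ENNReal.ofReal (s ^ (n / p)) ≠ 0 := by simpa using hs'
    rw [mul_assoc, ← mul_assoc (volume _), ENNReal.mul_inv_cancel hV0.1 hV0.2, one_mul, ← mul_assoc,
      ENNReal.mul_inv_cancel e0 ENNReal.ofReal_ne_top, one_mul]
  obtain ⟨C, hC⟩ : ∃ C : ℝ≥0∞, ∀ φ : (Fin n → ℝ) → ℝ≥0∞, Measurable φ →
      ∫⁻ y, φ y ∂(Measure.pi fun _ : Fin n => muP p)
      = C * ∫⁻ s, ∫⁻ x, φ (s ^ (1 / p) • x) ∂(uniformLpBall n p)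
        ∂(gammaMeasure (n / p + 1) (1 / p)) := by
    have hG := Real.Gamma_pos_of_pos ha
    have hrG : 0 < (1 / p) ^ (n / p + 1) / Real.Gamma (n / p + 1) := by positivity
    refine ⟨ENNReal.ofReal (muPConst p ^ n) * volume (lpBall n p) *
      ENNReal.ofReal (1 / p / ((1 / p) ^ (n / p + 1) / Real.Gamma (n / p + 1))), fun φ hφ => ?_⟩
    have hΦ : Measurable fun s : ℝ => ∫⁻ x, φ (s ^ (1 / p) • x) ∂(uniformLpBall n p) :=
      Measurable.lintegral_prod_right' (f := fun z : ℝ × (Fin n → ℝ) => φ (z.1 ^ (1 / p) • z.2))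
        (by fun_prop)
    have hSF : SigmaFinite ((volume : Measure ℝ).withDensity
        fun y : ℝ => ENNReal.ofReal (muPConst p * Real.exp (-(|y| ^ p) / p))) := by
      rw [← muP_eq]; infer_instance
    have hgm : Measurable (gammaPDF (n / p + 1) (1 / p)) :=
      (measurable_gammaPDFReal _ _).ennreal_ofReal
    rw [gammaMeasure, lintegral_withDensity_eq_lintegral_mul _ hgm hΦ,
      ← lintegral_const_mul _ (hgm.mul hΦ)]
    have hpm : Measurable fun y : Fin n → ℝ =>
        ∏ i, ENNReal.ofReal (muPConst p * Real.exp (-(|y i| ^ p) / p)) :=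
      Finset.measurable_prod _ fun i _ => (measurable_muPDensity p).comp (measurable_pi_apply i)
    simp_rw [muP_eq]
    rw [pi_withDensity_eq n _ (measurable_muPDensity p),
      lintegral_withDensity_eq_lintegral_mul _ hpm hφ]
    let D : Set ((Fin n → ℝ) × ℝ) := {z | 0 < z.2 ∧ N z.1 ≤ z.2}
    let F : (Fin n → ℝ) × ℝ → ℝ≥0∞ := D.indicator fun z => ENNReal.ofReal (muPConst p ^ n) *
      (ENNReal.ofReal (1 / p * Real.exp (-(1 / p * z.2))) * φ z.1)
    have hF : Measurable F := by
      refine Measurable.indicator (by fun_prop) ?_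
      exact (measurableSet_lt measurable_const measurable_snd).inter
        (measurableSet_le (hN.comp measurable_fst) measurable_snd)
    have h1 : ∀ y : Fin n → ℝ, (∏ i, ENNReal.ofReal (muPConst p * Real.exp (-(|y i| ^ p) / p))) * φ y
        = ∫⁻ s, F (y, s) := by
      intro y
      rw [← ENNReal.ofReal_prod_of_nonneg fun i _ => by positivity, Finset.prod_mul_distrib,
        ← Real.exp_sum, Finset.prod_const, Finset.card_univ, Fintype.card_fin, ← Finset.sum_div,
        Finset.sum_neg_distrib, ENNReal.ofReal_mul (by positivity),
        ofReal_exp_neg_div_eq_lintegral hp, mul_assoc, ← lintegral_mul_const _ (by fun_prop),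
        ← lintegral_const_mul _ (by fun_prop), ← lintegral_indicator measurableSet_Ioi]
      refine lintegral_congr_ae ?_
      filter_upwards [compl_mem_ae_iff.2 (measure_singleton (μ := volume) (N y))] with s hs
      rcases lt_or_ge (N y) s with h | h
      · rw [indicator_of_mem (show s ∈ Ioi (N y) from h)]
        simp only [F]
        rw [indicator_of_mem (show (y, s) ∈ D from ⟨(hN0 y).trans_lt h, h.le⟩)]
      · rw [indicator_of_notMem (show s ∉ Ioi (N y) from not_lt.2 h)]
        exact (indicator_of_notMem (show (y, s) ∉ D from fun h' => hs (le_antisymm h h'.2)) _).symm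
    simp only [Pi.mul_apply]
    simp_rw [h1]
    rw [lintegral_lintegral_swap (f := fun y s => F (y, s)) hF.aemeasurable]
    refine lintegral_congr_ae ?_
    filter_upwards [compl_mem_ae_iff.2 (measure_singleton (μ := volume) (0 : ℝ))] with s hs
    rcases lt_trichotomy s 0 with h | h | h
    · rw [gammaPDF_of_neg h, zero_mul, mul_zero]
      have : ∀ y, F (y, s) = 0 := fun y =>
        indicator_of_notMem (show (y, s) ∉ D from fun h' => absurd h'.1 (not_lt.2 h.le)) _
      simp [this]
    · exact absurd h hs
    · have : ∀ y, F (y, s) = ENNReal.ofReal (muPConst p ^ n) *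
          (ENNReal.ofReal (1 / p * Real.exp (-(1 / p * s))) * {y | N y ≤ s}.indicator φ y) := by
        intro y
        by_cases hy : N y ≤ s
        · rw [indicator_of_mem (show y ∈ {y | N y ≤ s} from hy)]
          exact indicator_of_mem (show (y, s) ∈ D from ⟨h, hy⟩) _
        · rw [indicator_of_notMem (show y ∉ {y | N y ≤ s} from hy), mul_zero, mul_zero]
          exact indicator_of_notMem (show (y, s) ∉ D from fun h' => hy h'.2) _
      simp_rw [this]
      have hind : Measurable ({y | N y ≤ s}.indicator φ) :=
        hφ.indicator (measurableSet_le hN measurable_const)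
      rw [lintegral_const_mul _ (hind.const_mul _), lintegral_const_mul _ hind, hsc φ hφ s h,
        gammaPDF_of_nonneg h.le, add_sub_cancel_right]
      rw [show 1 / p * Real.exp (-(1 / p * s)) = 1 / p / ((1 / p) ^ (n / p + 1) /
        Real.Gamma (n / p + 1)) * ((1 / p) ^ (n / p + 1) / Real.Gamma (n / p + 1) *
          Real.exp (-(1 / p * s))) by field_simp]
      rw [mul_right_comm _ (s ^ _), ENNReal.ofReal_mul (by positivity),
        ENNReal.ofReal_mul (by positivity) (q := s ^ _)]
      ring
  have h1 := hC 1 measurable_one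
  simp only [Pi.one_apply, lintegral_one, measure_univ, mul_one] at h1
  rw [hC φ hφ, ← h1, one_mul]

lemma lintegral_exp_gammaMeasure {a r l : ℝ} (ha : 0 < a) (hr : 0 < r) (hl : l < r) :
    ∫⁻ s, ENNReal.ofReal (Real.exp (l * s)) ∂(gammaMeasure a r)
      = ENNReal.ofReal ((r / (r - l)) ^ a) := by
  have hgm : ∀ r, Measurable (gammaPDF a r) := fun r =>
      (measurable_gammaPDFReal _ _).ennreal_ofReal
  have hrl : 0 < r - l := by linarith
  have hG := Real.Gamma_pos_of_pos ha
  rw [gammaMeasure, lintegral_withDensity_eq_lintegral_mul _ (hgm r) (by fun_prop)]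
  have : ∀ s, gammaPDF a r s * ENNReal.ofReal (Real.exp (l * s))
      = ENNReal.ofReal ((r / (r - l)) ^ a) * gammaPDF a (r - l) s := by
    intro s
    rcases lt_or_ge s 0 with hs | hs
    · simp [gammaPDF_of_neg hs]
    · rw [gammaPDF_of_nonneg hs, gammaPDF_of_nonneg hs, ← ENNReal.ofReal_mul (by positivity),
        ← ENNReal.ofReal_mul (by positivity), mul_assoc, ← Real.exp_add,
        Real.div_rpow hr.le hrl.le]
      congr 1
      have := Real.rpow_pos_of_pos hrl a
      rw [show -(r * s) + l * s = -((r - l) * s) by ring]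
      field_simp
  simp only [Pi.mul_apply, this]
  rw [lintegral_const_mul _ (hgm _), lintegral_gammaPDF_eq_one ha hrl, mul_one]

/-- The upper tail of `⟨y, g⟩`, for `y` with i.i.d. `μ_p` coordinates and `g` standard Gaussian. -/
def freeTail (n : ℕ) (p u : ℝ) : ℝ≥0∞ :=
  ((Measure.pi fun _ : Fin n => muP p).prod (gaussPi n)) {z | u ≤ dotp z.1 z.2}

/-- The upper tail of `⟨x, θ⟩`, for `x` uniform on the `ℓ^p` ball and `θ` distributed as `μ`. -/
def ballTail {n : ℕ} (p : ℝ) (μ : Measure (Fin n → ℝ)) (h : ℝ) : ℝ≥0∞ :=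
  ((uniformLpBall n p).prod μ) {z | h ≤ dotp z.1 z.2}

lemma measurableSet_le_dotp {n : ℕ} (u : ℝ) :
    MeasurableSet {z : (Fin n → ℝ) × (Fin n → ℝ) | u ≤ dotp z.1 z.2} :=
  measurableSet_le measurable_const (measurable_fst.dotp measurable_snd)

lemma freeTail_eq_lintegral {n : ℕ} {p : ℝ} (hp : 0 < p) [IsProbabilityMeasure (uniformLpBall n p)]
    {μ : Measure (Fin n → ℝ)} (hμ : IsUniformSphere μ) (u : ℝ) :
    freeTail n p u = ∫⁻ z, ((uniformLpBall n p).prod μ)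
        {w | u ≤ l2 z.2 * (z.1 ^ (1 / p) * dotp w.1 w.2)}
      ∂((gammaMeasure (n / p + 1) (1 / p)).prod (gaussPi n)) := by
  have hμp : IsProbabilityMeasure μ := hμ.1
  have := isProbabilityMeasure_muP hp
  have := isProbabilityMeasure_gammaMeasure (show (0 : ℝ) < n / p + 1 by positivity)
    (show 0 < 1 / p by positivity)
  have hm : MeasurableSet {q : (ℝ × (Fin n → ℝ)) × ((Fin n → ℝ) × (Fin n → ℝ)) |
      u ≤ l2 q.1.2 * (q.1.1 ^ (1 / p) * dotp q.2.1 q.2.2)} := by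
    refine measurableSet_le measurable_const ?_
    have := (measurable_l2 (n := n)).comp
      (measurable_snd.comp measurable_fst : Measurable
        fun q : (ℝ × (Fin n → ℝ)) × ((Fin n → ℝ) × (Fin n → ℝ)) => q.1.2)
    exact this.mul ((by fun_prop : Measurable
        fun q : (ℝ × (Fin n → ℝ)) × ((Fin n → ℝ) × (Fin n → ℝ)) => q.1.1 ^ (1 / p)).mul
      (Measurable.dotp (by fun_prop) (by fun_prop)))
  have hm' : ∀ s : ℝ, MeasurableSet {q : ((Fin n → ℝ) × (Fin n → ℝ)) × (Fin n → ℝ) |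
      u ≤ l2 q.1.2 * (s ^ (1 / p) * dotp q.1.1 q.2)} := fun s =>
    hm.preimage (f := fun q : ((Fin n → ℝ) × (Fin n → ℝ)) × (Fin n → ℝ) =>
      ((s, q.1.2), (q.1.1, q.2))) (by fun_prop)
  rw [freeTail, Measure.prod_apply (measurableSet_le_dotp u),
    lintegral_pi_muP_eq_mixture hp (measurable_measure_prodMk_left (measurableSet_le_dotp u)),
    lintegral_prod (fun z => ((uniformLpBall n p).prod μ)
      {w | u ≤ l2 z.2 * (z.1 ^ (1 / p) * dotp w.1 w.2)})
      (measurable_measure_prodMk_left (ν := (uniformLpBall n p).prod μ) hm).aemeasurable]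
  refine lintegral_congr fun s => ?_
  have hx : ∀ x : Fin n → ℝ, gaussPi n (Prod.mk (s ^ (1 / p) • x) ⁻¹' {z | u ≤ dotp z.1 z.2})
      = ∫⁻ g, μ {θ | u ≤ l2 g * (s ^ (1 / p) * dotp x θ)} ∂gaussPi n := fun x => by
    refine (gaussPi_le_dotp_eq_lintegral hμ (s ^ (1 / p) • x) u).trans ?_
    simp_rw [dotp_smul_left]
  simp_rw [hx]
  have hsw := lintegral_lintegral_swap (μ := uniformLpBall n p) (ν := gaussPi n)
    (f := fun x g => μ {θ | u ≤ l2 g * (s ^ (1 / p) * dotp x θ)})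
    (measurable_measure_prodMk_left (hm' s)).aemeasurable
  rw [hsw]
  refine lintegral_congr fun g => ?_
  exact (Measure.prod_apply (hm.preimage (f := fun q : (Fin n → ℝ) × (Fin n → ℝ) => ((s, g), q))
    (by fun_prop))).symm

lemma le_freeTail {n : ℕ} {p : ℝ} (hp : 0 < p) [IsProbabilityMeasure (uniformLpBall n p)]
    {μ : Measure (Fin n → ℝ)} (hμ : IsUniformSphere μ) {h σ κ : ℝ} (hh : 0 ≤ h) (hσ : 0 < σ)
    (hκ : 0 < κ) :
    gammaMeasure (n / p + 1) (1 / p) (Ici σ) * gaussPi n {g | κ ≤ l2 g} * ballTail p μ h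
      ≤ freeTail n p (σ ^ (1 / p) * κ * h) := by
  have hμp : IsProbabilityMeasure μ := hμ.1
  have := isProbabilityMeasure_gammaMeasure (show (0 : ℝ) < n / p + 1 by positivity)
    (show 0 < 1 / p by positivity)
  have hl := measurableSet_le measurable_const (measurable_l2 (n := n)) (f := fun _ => κ)
  rw [freeTail_eq_lintegral hp hμ, ← Measure.prod_prod, mul_comm, ← setLIntegral_const]
  refine (setLIntegral_mono' (measurableSet_Ici.prod hl) fun z hz => measure_mono fun w hw => ?_).trans
    (setLIntegral_le_lintegral _ _)
  have hz1 : σ ≤ z.1 := hz.1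
  have hz2 : κ ≤ l2 z.2 := hz.2
  have hw' : h ≤ dotp w.1 w.2 := hw
  have h1 : σ ^ (1 / p) ≤ z.1 ^ (1 / p) := Real.rpow_le_rpow hσ.le hz1 (by positivity)
  have h0 : 0 < σ ^ (1 / p) := by positivity
  show σ ^ (1 / p) * κ * h ≤ l2 z.2 * (z.1 ^ (1 / p) * dotp w.1 w.2)
  calc σ ^ (1 / p) * κ * h = κ * (σ ^ (1 / p) * h) := by ring
    _ ≤ _ := by gcongr <;> linarith

lemma freeTail_le {n : ℕ} {p : ℝ} (hp : 0 < p) [IsProbabilityMeasure (uniformLpBall n p)]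
    {μ : Measure (Fin n → ℝ)} (hμ : IsUniformSphere μ) {h σ κ : ℝ} (hh : 0 < h) (hσ : 0 < σ)
    (hκ : 0 < κ) :
    freeTail n p (σ ^ (1 / p) * κ * h) ≤
      gammaMeasure (n / p + 1) (1 / p) (Ici σ) + gaussPi n {g | κ ≤ l2 g} + ballTail p μ h := by
  have hμp : IsProbabilityMeasure μ := hμ.1
  have := isProbabilityMeasure_gammaMeasure (show (0 : ℝ) < n / p + 1 by positivity)
    (show 0 < 1 / p by positivity)
  set ρ := gammaMeasure (n / p + 1) (1 / p)
  have hl := measurableSet_le measurable_const (measurable_l2 (n := n)) (f := fun _ => κ)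
  have h0 : 0 < σ ^ (1 / p) := by positivity
  have hρ0 : ∀ᵐ s ∂ρ, 0 ≤ s := by
    rw [ae_iff]
    simp only [not_le]
    show ρ (Iio 0) = 0
    rw [show ρ = gammaMeasure (n / p + 1) (1 / p) from rfl, gammaMeasure,
      withDensity_apply _ measurableSet_Iio, lintegral_gammaPDF_of_nonpos le_rfl]
  have hae : ∀ᵐ z ∂(ρ.prod (gaussPi n)), 0 ≤ z.1 :=
    (Measure.quasiMeasurePreserving_fst (μ := ρ) (ν := gaussPi n)).ae hρ0
  rw [freeTail_eq_lintegral hp hμ]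
  calc ∫⁻ z, ((uniformLpBall n p).prod μ)
        {w | σ ^ (1 / p) * κ * h ≤ l2 z.2 * (z.1 ^ (1 / p) * dotp w.1 w.2)} ∂(ρ.prod (gaussPi n))
      ≤ ∫⁻ z, ((Ici σ ×ˢ univ).indicator 1 z + (univ ×ˢ {g | κ ≤ l2 g}).indicator 1 z
          + ballTail p μ h) ∂(ρ.prod (gaussPi n)) := by
        refine lintegral_mono_ae ?_
        filter_upwards [hae] with z hz
        by_cases h1 : σ ≤ z.1
        · rw [indicator_of_mem (show z ∈ Ici σ ×ˢ univ from ⟨h1, mem_univ _⟩), Pi.one_apply, add_assoc]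
          exact prob_le_one.trans le_self_add
        by_cases h2 : κ ≤ l2 z.2
        · rw [indicator_of_mem (show z ∈ univ ×ˢ {g | κ ≤ l2 g} from ⟨mem_univ _, h2⟩), Pi.one_apply]
          exact prob_le_one.trans (le_add_self.trans le_self_add)
        refine (measure_mono fun w hw => ?_).trans le_add_self
        have hw' : σ ^ (1 / p) * κ * h ≤ l2 z.2 * (z.1 ^ (1 / p) * dotp w.1 w.2) := hw
        push Not at h1 h2
        have h3 : z.1 ^ (1 / p) ≤ σ ^ (1 / p) := Real.rpow_le_rpow hz h1.le (by positivity)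
        have h4 : 0 ≤ z.1 ^ (1 / p) := by positivity
        have h5 : 0 ≤ l2 z.2 := Real.sqrt_nonneg _
        show h ≤ dotp w.1 w.2
        by_contra hlt
        push Not at hlt
        have h6 : l2 z.2 * (z.1 ^ (1 / p) * dotp w.1 w.2) < σ ^ (1 / p) * κ * h := by
          rcases le_or_gt (dotp w.1 w.2) 0 with hd | hd
          · have : l2 z.2 * (z.1 ^ (1 / p) * dotp w.1 w.2) ≤ 0 :=
              mul_nonpos_of_nonneg_of_nonpos h5 (mul_nonpos_of_nonneg_of_nonpos h4 hd)
            exact this.trans_lt (by positivity)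
          · calc l2 z.2 * (z.1 ^ (1 / p) * dotp w.1 w.2) ≤ κ * (σ ^ (1 / p) * dotp w.1 w.2) := by
                  gcongr
              _ < κ * (σ ^ (1 / p) * h) := by gcongr
              _ = _ := by ring
        linarith
    _ = _ := by
        have m1 : MeasurableSet (Ici σ ×ˢ (univ : Set (Fin n → ℝ))) := measurableSet_Ici.prod .univ
        have m2 : MeasurableSet ((univ : Set ℝ) ×ˢ {g : Fin n → ℝ | κ ≤ l2 g}) := .prod .univ hl
        rw [lintegral_add_right _ measurable_const, lintegral_add_left (measurable_one.indicator m1),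
          lintegral_indicator_one m1, lintegral_indicator_one m2, Measure.prod_prod,
          Measure.prod_prod]
        simp

lemma measure_ge_le_exp_mul_lintegral {α : Type*} [MeasurableSpace α] {μ : Measure α} {f : α → ℝ}
    (hf : Measurable f) {l : ℝ} (hl : 0 ≤ l) (a : ℝ) :
    μ {x | a ≤ f x} ≤
      ENNReal.ofReal (Real.exp (-(l * a))) * ∫⁻ x, ENNReal.ofReal (Real.exp (l * f x)) ∂μ := by
  have h := mul_meas_ge_le_lintegral (μ := μ) (f := fun x => ENNReal.ofReal (Real.exp (l * f x)))
    (by fun_prop) (ENNReal.ofReal (Real.exp (l * a)))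
  calc μ {x | a ≤ f x}
      = ENNReal.ofReal (Real.exp (-(l * a))) *
        (ENNReal.ofReal (Real.exp (l * a)) * μ {x | a ≤ f x}) := by
        rw [← mul_assoc, ← ENNReal.ofReal_mul (Real.exp_pos _).le, ← Real.exp_add]
        simp
    _ ≤ _ := by
        gcongr
        refine le_trans ?_ h
        gcongr
        intro hx
        gcongr

/-- Chernoff bounds for a function whose Laplace transform is comparable with that of a sum of `n`
independent variables of mean one. -/
lemma exists_exp_decay_of_lintegral_exp_le {q ε : ℝ} (hq : 0 < q) (hε : 0 < ε) (hε1 : ε < 1) :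
    ∃ c : ℝ, 0 < c ∧ ∀ (n : ℕ) {α : Type} [MeasurableSpace α] (μ : Measure α) (f : α → ℝ),
      Measurable f → (∀ l : ℝ, |q * l| ≤ 1 / 2 → ∫⁻ x, ENNReal.ofReal (Real.exp (l * f x)) ∂μ ≤
        ENNReal.ofReal (2 * (1 - q * l) ^ (-(n / q)))) →
      μ {x | n * (1 + ε) ≤ f x} ≤ ENNReal.ofReal (2 * Real.exp (-(c * n))) ∧
      μ {x | f x ≤ n * (1 - ε)} ≤ ENNReal.ofReal (2 * Real.exp (-(c * n))) := by
  set x := ε / (2 * (1 + ε)) with hx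
  have hx0 : 0 < x := by positivity
  have hx1 : x < 1 / 2 := by rw [hx, div_lt_div_iff₀ (by positivity) (by positivity)]; linarith
  have hxε : x < ε := by rw [hx, div_lt_iff₀ (by positivity)]; nlinarith
  have hd1 : 0 < Real.log (1 - x) + x * (1 + ε) := by
    have h1 := Real.one_sub_inv_le_log_of_pos (show 0 < 1 - x by linarith)
    have h2 : x * (1 + ε) = ε / 2 := by rw [hx]; field_simp
    have h3 : (1 - x)⁻¹ = 1 + ε / (2 + ε) := by
      rw [hx]; rw [inv_eq_iff_eq_inv]; field_simp; ring_nf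
    have h4 : ε / (2 + ε) < ε / 2 := by gcongr; linarith
    linarith
  have hd2 : 0 < Real.log (1 + x) - x * (1 - ε) := by
    have h1 := Real.one_sub_inv_le_log_of_pos (show 0 < 1 + x by linarith)
    have h3 : x * (1 - ε) < 1 - (1 + x)⁻¹ := by
      rw [show 1 - (1 + x)⁻¹ = x / (1 + x) by field_simp; ring, lt_div_iff₀ (by linarith)]
      nlinarith [mul_pos hx0 (sub_pos.2 hxε), mul_pos (mul_pos hx0 hx0) hε]
    linarith
  set d := min (Real.log (1 - x) + x * (1 + ε)) (Real.log (1 + x) - x * (1 - ε)) with hd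
  have hd0 : 0 < d := lt_min hd1 hd2
  refine ⟨d / q, by positivity, fun n α _ μ f hf h => ⟨?_, ?_⟩⟩
  · have h1 := h (x / q) (by
      rw [mul_div_cancel₀ _ hq.ne', abs_of_pos hx0]; exact hx1.le)
    refine (measure_ge_le_exp_mul_lintegral hf (l := x / q) (by positivity) _).trans ?_
    refine (mul_le_mul_right h1 _).trans ?_
    rw [← ENNReal.ofReal_mul (Real.exp_pos _).le, mul_div_cancel₀ _ hq.ne',
      Real.rpow_def_of_pos (by linarith), mul_left_comm, ← Real.exp_add]
    refine ENNReal.ofReal_le_ofReal ?_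
    gcongr
    have : d * (n / q) ≤ (Real.log (1 - x) + x * (1 + ε)) * (n / q) := by
      gcongr; exact min_le_left _ _
    have e1 : x / q * (n * (1 + ε)) = x * (1 + ε) * (n / q) := by ring
    have e2 : d / q * n = d * (n / q) := by ring
    rw [e1, e2]; linarith
  · have h1 := h (-(x / q)) (by
      rw [mul_neg, mul_div_cancel₀ _ hq.ne', abs_neg, abs_of_pos hx0]; exact hx1.le)
    have h2 := measure_ge_le_exp_mul_lintegral (μ := μ) hf.neg (l := x / q) (by positivity)
      (-(n * (1 - ε)))
    simp only [Pi.neg_apply, neg_le_neg_iff] at h2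
    refine h2.trans ?_
    simp only [mul_neg, neg_mul, neg_neg] at h1 ⊢
    refine (mul_le_mul_right h1 _).trans ?_
    rw [← ENNReal.ofReal_mul (Real.exp_pos _).le, mul_div_cancel₀ _ hq.ne', sub_neg_eq_add,
      Real.rpow_def_of_pos (by linarith), mul_left_comm, ← Real.exp_add]
    refine ENNReal.ofReal_le_ofReal ?_
    gcongr
    have : d * (n / q) ≤ (Real.log (1 + x) - x * (1 - ε)) * (n / q) := by
      gcongr; exact min_le_right _ _
    have e1 : x / q * (n * (1 - ε)) = x * (1 - ε) * (n / q) := by ring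
    have e2 : d / q * n = d * (n / q) := by ring
    rw [e1, e2]; linarith

lemma lintegral_exp_gammaMeasure_le {p l : ℝ} (hp : 0 < p) (n : ℕ) (hl : |p * l| ≤ 1 / 2) :
    ∫⁻ s, ENNReal.ofReal (Real.exp (l * s)) ∂(gammaMeasure (n / p + 1) (1 / p)) ≤
      ENNReal.ofReal (2 * (1 - p * l) ^ (-(n / p))) := by
  have h1 : p * l ≤ 1 / 2 := (le_abs_self _).trans hl
  have h2 : 0 < 1 - p * l := by linarith
  have h3 : l < 1 / p := by rw [lt_div_iff₀ hp]; linarith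
  rw [lintegral_exp_gammaMeasure (by positivity) (by positivity) h3]
  refine ENNReal.ofReal_le_ofReal ?_
  have h4 : 1 / p / (1 / p - l) = (1 - p * l)⁻¹ := by
    have : 1 / p - l = (1 - p * l) / p := by field_simp
    rw [this]; field_simp
  rw [h4, Real.rpow_add_one (by positivity), Real.inv_rpow h2.le, Real.rpow_neg h2.le, mul_comm]
  gcongr
  rw [inv_le_comm₀ h2 (by norm_num)]
  linarith

lemma lintegral_exp_mul_l2_sq_le {l : ℝ} (n : ℕ) (hl : |2 * l| ≤ 1 / 2) :
    ∫⁻ g, ENNReal.ofReal (Real.exp (l * l2 g ^ 2)) ∂(gaussPi n) ≤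
      ENNReal.ofReal (2 * (1 - 2 * l) ^ (-(n / 2 : ℝ))) := by
  have h1 : 2 * l ≤ 1 / 2 := (le_abs_self _).trans hl
  have h2 : 0 < 1 - 2 * l := by linarith
  have e : ∀ g : Fin n → ℝ, ENNReal.ofReal (Real.exp (l * l2 g ^ 2))
      = ∏ i, ENNReal.ofReal (Real.exp (l * |g i| ^ (2 : ℝ))) := by
    intro g
    rw [← ENNReal.ofReal_prod_of_nonneg fun i _ => (Real.exp_pos _).le, ← Real.exp_sum,
      ← Finset.mul_sum, l2_sq]
    simp
  simp_rw [e]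
  rw [gaussPi, lintegral_pi_prod_eq n (fun _ => muP 2)
    (fun _ y => ENNReal.ofReal (Real.exp (l * |y| ^ (2 : ℝ)))) (by fun_prop)]
  simp_rw [lintegral_exp_mul_abs_rpow_muP (q := 2) (by norm_num) (show 2 * l < 1 by linarith)]
  rw [Finset.prod_const, Finset.card_univ, Fintype.card_fin, ← ENNReal.ofReal_pow (by positivity),
    ← Real.rpow_natCast, ← Real.rpow_mul h2.le]
  refine ENNReal.ofReal_le_ofReal ?_
  rw [show -1 / 2 * (n : ℝ) = -(n / 2) by ring]
  have : 0 < (1 - 2 * l) ^ (-(n / 2 : ℝ)) := by positivity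
  linarith

lemma rpow_mul_sqrt_mul_eq {p n δ w : ℝ} (hn : 0 < n) (hδ : 0 < δ) :
    (n * δ) ^ (1 / p) * √(n * δ) * (n ^ (1 / 2 - 1 / p) * w) = n * (δ ^ (1 / p + 1 / 2) * w) := by
  rw [Real.sqrt_eq_rpow, ← Real.rpow_add (by positivity), Real.mul_rpow hn.le hδ.le,
    Real.rpow_sub hn, Real.rpow_add hn]
  have : 0 < n ^ (1 / p) := by positivity
  have h2 : n ^ (1 / 2 : ℝ) * n ^ (1 / 2 : ℝ) = n := by
    rw [← Real.rpow_add hn]; norm_num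
  field_simp
  linear_combination w * h2

lemma exists_freeTail_le_ballTail {p ε : ℝ} (hp : 0 < p) (hε : 0 < ε) (hε1 : ε < 1) :
    ∃ c : ℝ, 0 < c ∧ ∀ (n : ℕ) (μ : Measure (Fin n → ℝ)) (w : ℝ), 0 < n →
      IsProbabilityMeasure (uniformLpBall n p) → IsUniformSphere μ → 0 < w →
      freeTail n p (n * ((1 + ε) ^ (1 / p + 1 / 2) * w)) ≤
        ENNReal.ofReal (4 * Real.exp (-(c * n))) + ballTail p μ (n ^ (1 / 2 - 1 / p) * w) := by
  obtain ⟨c1, hc1, H1⟩ := exists_exp_decay_of_lintegral_exp_le hp hε hε1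
  obtain ⟨c2, hc2, H2⟩ := exists_exp_decay_of_lintegral_exp_le (q := 2) two_pos hε hε1
  refine ⟨min c1 c2, lt_min hc1 hc2, fun n μ w hn hU hμ hw => ?_⟩
  have hn' : (0 : ℝ) < n := by exact_mod_cast hn
  have h1 := (H1 n (gammaMeasure (n / p + 1) (1 / p)) id measurable_id
    fun l hl => lintegral_exp_gammaMeasure_le hp n hl).1
  have h2 := (H2 n (gaussPi n) (fun g => l2 g ^ 2) (measurable_l2.pow_const 2)
    fun l hl => lintegral_exp_mul_l2_sq_le n hl).1
  have h3 := freeTail_le hp hμ (h := n ^ (1 / 2 - 1 / p) * w) (σ := n * (1 + ε))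
    (κ := √(n * (1 + ε))) (by positivity) (by positivity) (by positivity)
  rw [rpow_mul_sqrt_mul_eq hn' (by positivity)] at h3
  refine h3.trans ?_
  gcongr
  have h4 : {g : Fin n → ℝ | √(n * (1 + ε)) ≤ l2 g} = {g | n * (1 + ε) ≤ l2 g ^ 2} := by
    ext g
    exact Real.sqrt_le_left (Real.sqrt_nonneg _)
  rw [h4, show 4 * Real.exp (-(min c1 c2 * n)) = 2 * Real.exp (-(min c1 c2 * n)) +
    2 * Real.exp (-(min c1 c2 * n)) by ring, ENNReal.ofReal_add (by positivity) (by positivity)]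
  refine add_le_add (h1.trans (ENNReal.ofReal_le_ofReal ?_))
    (h2.trans (ENNReal.ofReal_le_ofReal ?_))
  · gcongr; exact min_le_left _ _
  · gcongr; exact min_le_right _ _

lemma inv_two_le_measure_of_compl {α : Type*} [MeasurableSpace α] (ν : Measure α)
    [IsProbabilityMeasure ν] (A : Set α) (hA : ν Aᶜ ≤ ENNReal.ofReal (1 / 2)) : 2⁻¹ ≤ ν A := by
  have h1 : 1 ≤ ν A + ν Aᶜ := by
    rw [← measure_univ (μ := ν), ← union_compl_self A]; exact measure_union_le _ _
  have h2 : (1 : ℝ≥0∞) ≤ ν A + 2⁻¹ := by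
    refine h1.trans ?_
    gcongr
    refine hA.trans_eq ?_
    rw [one_div, ENNReal.ofReal_inv_of_pos two_pos]; norm_num
  rw [← ENNReal.inv_two_add_inv_two] at h2
  exact (ENNReal.add_le_add_iff_right (by norm_num)).1 h2

lemma exists_ballTail_le_freeTail {p ε : ℝ} (hp : 0 < p) (hε : 0 < ε) (hε1 : ε < 1) :
    ∀ᶠ n : ℕ in atTop, ∀ (μ : Measure (Fin n → ℝ)) (w : ℝ),
      IsProbabilityMeasure (uniformLpBall n p) → IsUniformSphere μ → 0 < w →
      ballTail p μ (n ^ (1 / 2 - 1 / p) * w) ≤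
        4 * freeTail n p (n * ((1 - ε) ^ (1 / p + 1 / 2) * w)) := by
  obtain ⟨c1, hc1, H1⟩ := exists_exp_decay_of_lintegral_exp_le hp hε hε1
  obtain ⟨c2, hc2, H2⟩ := exists_exp_decay_of_lintegral_exp_le (q := 2) two_pos hε hε1
  have hlim : ∀ c : ℝ, 0 < c → ∀ᶠ n : ℕ in atTop, 2 * Real.exp (-(c * n)) ≤ 1 / 2 := by
    intro c hc
    have : Tendsto (fun n : ℕ => 2 * Real.exp (-(c * n))) atTop (𝓝 (2 * 0)) :=
      (Real.tendsto_exp_neg_atTop_nhds_zero.comp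
        (tendsto_natCast_atTop_atTop.const_mul_atTop hc)).const_mul 2
    exact this.eventually_le_const (by norm_num)
  filter_upwards [hlim c1 hc1, hlim c2 hc2, eventually_gt_atTop 0] with n hn1 hn2 hn μ w hU hμ hw
  have hn' : (0 : ℝ) < n := by exact_mod_cast hn
  have := isProbabilityMeasure_gammaMeasure (show (0 : ℝ) < n / p + 1 by positivity)
    (show 0 < 1 / p by positivity)
  have h1 := (H1 n (gammaMeasure (n / p + 1) (1 / p)) id measurable_id
    fun l hl => lintegral_exp_gammaMeasure_le hp n hl).2.trans (ENNReal.ofReal_le_ofReal hn1)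
  have h2 := (H2 n (gaussPi n) (fun g => l2 g ^ 2) (measurable_l2.pow_const 2)
    fun l hl => lintegral_exp_mul_l2_sq_le n hl).2.trans (ENNReal.ofReal_le_ofReal hn2)
  have hδ : 0 < 1 - ε := by linarith
  have h3 := le_freeTail hp hμ (h := n ^ (1 / 2 - 1 / p) * w) (σ := n * (1 - ε))
    (κ := √(n * (1 - ε))) (by positivity) (by positivity) (by positivity)
  rw [rpow_mul_sqrt_mul_eq hn' hδ] at h3
  have h4 : 2⁻¹ ≤ gammaMeasure (n / p + 1) (1 / p) (Ici (n * (1 - ε))) := by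
    refine inv_two_le_measure_of_compl _ _ (le_trans (measure_mono fun s hs => ?_) h1)
    exact (not_le.1 (mem_Ici.not.1 hs)).le
  have h5 : 2⁻¹ ≤ gaussPi n {g | √(n * (1 - ε)) ≤ l2 g} := by
    refine inv_two_le_measure_of_compl _ _ (le_trans (measure_mono fun g hg => ?_) h2)
    have h6 : ¬ √(n * (1 - ε)) ≤ l2 g := hg
    rw [Real.sqrt_le_left (show 0 ≤ l2 g from Real.sqrt_nonneg _)] at h6
    exact (not_le.1 h6).le
  have h7 : ∀ b : ℝ≥0∞, b = 4 * (2⁻¹ * 2⁻¹ * b) := fun b => by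
    rw [← mul_assoc, show (4 : ℝ≥0∞) = 2 * 2 by norm_num, mul_mul_mul_comm,
      ENNReal.mul_inv_cancel (by norm_num) (by norm_num), one_mul, one_mul]
  rw [h7 (ballTail p μ _)]
  exact mul_le_mul_right ((mul_le_mul_left (mul_le_mul' h4 h5) _).trans h3) _

lemma exp_add_exp_neg_le (t : ℝ) : Real.exp t + Real.exp (-t) ≤ 2 + t ^ 2 * Real.exp |t| := by
  wlog ht : 0 ≤ t generalizing t
  · have := this (-t) (by linarith)
    rwa [neg_neg, neg_sq, abs_neg, add_comm] at this
  rw [abs_of_nonneg ht]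
  have h1 : 0 ≤ 1 - Real.exp (-t) := by simpa using ht
  have h2 : 1 - Real.exp (-t) ≤ t := by linarith [Real.add_one_le_exp (-t)]
  have h3 : Real.exp t * Real.exp (-t) = 1 := by rw [← Real.exp_add]; simp
  have h4 : (1 - Real.exp (-t)) ^ 2 ≤ t ^ 2 := by gcongr
  nlinarith [mul_le_mul_of_nonneg_right h4 (Real.exp_pos t).le]

/-- An upper bound for the tail of a sum of independent symmetric variables with stretched
exponential moments. -/
lemma pi_le_sum_le {ν : Measure ℝ} [IsProbabilityMeasure ν] (hneg : ν.map (fun t => -t) = ν)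
    {r c K N : ℝ} (hr : 0 < r) (hr1 : r ≤ 1) (hc : 0 < c) (hN : 0 < N) (hK : 0 ≤ K)
    (hK0 : ∫⁻ t, ENNReal.ofReal (Real.exp (c * |t| ^ r)) ∂ν ≤ ENNReal.ofReal K)
    (hK2 : ∫⁻ t, ENNReal.ofReal (t ^ 2 * Real.exp (c * |t| ^ r)) ∂ν ≤ ENNReal.ofReal K) (n : ℕ) :
    (Measure.pi fun _ : Fin n => ν) {v | N ≤ ∑ i, v i} ≤
      ENNReal.ofReal (Real.exp (-(c * N ^ r)) *
        (n * K + Real.exp (n * (K * (c * N ^ (r - 1)) ^ 2)))) := by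
  set l := c * N ^ (r - 1) with hl
  have hl0 : 0 < l := by positivity
  have hlN : l * N = c * N ^ r := by
    rw [hl, mul_assoc, ← Real.rpow_add_one hN.ne', sub_add_cancel]
  let φ : ℝ → ℝ≥0∞ := (Iic N).indicator fun t => ENNReal.ofReal (Real.exp (l * t))
  have hφ : Measurable φ := Measurable.indicator (by fun_prop) measurableSet_Iic
  have hφ2 : ∀ t, φ t + φ (-t) ≤ 2 + ENNReal.ofReal (l ^ 2) *
      ENNReal.ofReal (t ^ 2 * Real.exp (c * |t| ^ r)) := by
    intro t
    rcases le_or_gt |t| N with h | h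
    · have h1 := abs_le.1 h
      simp only [φ]
      rw [indicator_of_mem (show t ∈ Iic N from h1.2),
        indicator_of_mem (show -t ∈ Iic N from by rw [mem_Iic]; linarith),
        ← ENNReal.ofReal_add (by positivity) (by positivity), ← ENNReal.ofReal_mul (by positivity),
        ← ENNReal.ofReal_ofNat, ← ENNReal.ofReal_add (by positivity) (by positivity)]
      refine ENNReal.ofReal_le_ofReal ?_
      rw [mul_neg]
      refine (exp_add_exp_neg_le (l * t)).trans ?_
      rw [mul_pow, mul_assoc]
      gcongr
      rw [abs_mul, abs_of_pos hl0, hl, mul_assoc]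
      gcongr
      rcases eq_or_ne t 0 with rfl | ht
      · simp [Real.zero_rpow hr.ne']
      have ht' : 0 < |t| := abs_pos.2 ht
      calc N ^ (r - 1) * |t| ≤ |t| ^ (r - 1) * |t| := by
            gcongr ?_ * _
            exact Real.rpow_le_rpow_of_nonpos ht' h (by linarith)
        _ = |t| ^ r := by rw [← Real.rpow_add_one ht'.ne', sub_add_cancel]
    · refine le_trans ?_ le_self_add
      rw [← one_add_one_eq_two]
      have hle : ∀ s : ℝ, N < |s| → φ s ≤ 1 := by
        intro s hs
        simp only [φ]
        by_cases hsN : s ≤ N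
        · have hs0 : s ≤ 0 := by
            by_contra! h0
            rw [abs_of_pos h0] at hs
            linarith
          rw [indicator_of_mem (show s ∈ Iic N from hsN), ← ENNReal.ofReal_one]
          exact ENNReal.ofReal_le_ofReal
            (Real.exp_le_one_iff.2 (mul_nonpos_of_nonneg_of_nonpos hl0.le hs0))
        · rw [indicator_of_notMem (show s ∉ Iic N from hsN)]
          exact zero_le_one
      exact add_le_add (hle t h) (hle (-t) (by rwa [abs_neg]))
  have hφint : ∫⁻ t, φ t ∂ν ≤ ENNReal.ofReal (Real.exp (K * l ^ 2)) := by
    have h1 : ∫⁻ t, φ (-t) ∂ν = ∫⁻ t, φ t ∂ν := by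
      conv_rhs => rw [← hneg]
      rw [lintegral_map hφ (by fun_prop)]
    have h2 : 2 * ∫⁻ t, φ t ∂ν ≤ 2 * ENNReal.ofReal (1 + K * l ^ 2) := by
      calc 2 * ∫⁻ t, φ t ∂ν = ∫⁻ t, φ t + φ (-t) ∂ν := by
            rw [lintegral_add_left hφ, h1, two_mul]
        _ ≤ ∫⁻ t, 2 + ENNReal.ofReal (l ^ 2) *
              ENNReal.ofReal (t ^ 2 * Real.exp (c * |t| ^ r)) ∂ν := lintegral_mono hφ2
        _ ≤ 2 + ENNReal.ofReal (l ^ 2) * ENNReal.ofReal K := by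
            rw [lintegral_add_left measurable_const, lintegral_const_mul _ (by fun_prop)]
            simp only [lintegral_const, measure_univ, mul_one]
            gcongr
        _ ≤ _ := by
            rw [← ENNReal.ofReal_mul (by positivity), ← ENNReal.ofReal_ofNat,
              ← ENNReal.ofReal_add (by positivity) (by positivity),
              ← ENNReal.ofReal_mul (by positivity)]
            refine ENNReal.ofReal_le_ofReal ?_
            have : 0 ≤ K * l ^ 2 := by positivity
            linarith
    refine ((ENNReal.mul_le_mul_iff_right two_ne_zero (by norm_num)).1 h2).trans
      (ENNReal.ofReal_le_ofReal ?_)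
    linarith [Real.add_one_le_exp (K * l ^ 2)]
  have htail : ν (Ici N) ≤ ENNReal.ofReal (Real.exp (-(c * N ^ r)) * K) := by
    rw [ENNReal.ofReal_mul (by positivity)]
    refine le_trans (measure_mono fun t ht => ?_) ((measure_ge_le_exp_mul_lintegral (μ := ν)
      (f := fun t => |t| ^ r) (by fun_prop) hc.le (N ^ r)).trans (mul_le_mul_right hK0 _))
    exact Real.rpow_le_rpow hN.le ((mem_Ici.1 ht).trans (le_abs_self t)) hr.le
  let A : Set (Fin n → ℝ) := {v | N ≤ ∑ i, v i ∧ ∀ i, v i ≤ N}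
  have hA : (Measure.pi fun _ : Fin n => ν) A ≤
      ENNReal.ofReal (Real.exp (-(c * N ^ r)) * Real.exp (n * (K * l ^ 2))) := by
    have hAm : MeasurableSet A := by
      refine (measurableSet_le measurable_const
        (by fun_prop : Measurable fun v : Fin n → ℝ => ∑ i, v i)).inter ?_
      show MeasurableSet {v : Fin n → ℝ | ∀ i, v i ≤ N}
      rw [ofPred_forall]
      exact MeasurableSet.iInter fun i => measurableSet_le (by fun_prop) measurable_const
    have h1 : ∀ v, A.indicator (1 : (Fin n → ℝ) → ℝ≥0∞) v ≤
        ENNReal.ofReal (Real.exp (-(c * N ^ r))) * ∏ i, φ (v i) := by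
      intro v
      by_cases hv : v ∈ A
      · have h2 : ∏ i, φ (v i) = ENNReal.ofReal (Real.exp (l * ∑ i, v i)) := by
          rw [Finset.mul_sum, Real.exp_sum, ENNReal.ofReal_prod_of_nonneg fun i _ => (Real.exp_pos _).le]
          refine Finset.prod_congr rfl fun i _ => ?_
          simp only [φ]
          rw [indicator_of_mem (show v i ∈ Iic N from hv.2 i)]
        rw [indicator_of_mem hv, h2, ← ENNReal.ofReal_mul (by positivity), ← Real.exp_add, ← hlN,
          Pi.one_apply, ← ENNReal.ofReal_one]
        refine ENNReal.ofReal_le_ofReal (Real.one_le_exp ?_)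
        nlinarith [mul_le_mul_of_nonneg_left hv.1 hl0.le]
      · rw [indicator_of_notMem hv]; exact zero_le
    calc (Measure.pi fun _ : Fin n => ν) A
        = ∫⁻ v, A.indicator 1 v ∂(Measure.pi fun _ : Fin n => ν) := (lintegral_indicator_one hAm).symm
      _ ≤ ∫⁻ v, ENNReal.ofReal (Real.exp (-(c * N ^ r))) * ∏ i, φ (v i)
            ∂(Measure.pi fun _ : Fin n => ν) := lintegral_mono h1
      _ = ENNReal.ofReal (Real.exp (-(c * N ^ r))) * (∫⁻ t, φ t ∂ν) ^ n := by
          have hprod : Measurable fun v : Fin n → ℝ => ∏ i, φ (v i) :=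
            Finset.measurable_prod _ fun i _ => hφ.comp (measurable_pi_apply i)
          rw [lintegral_const_mul _ hprod,
            lintegral_pi_prod_eq n (fun _ => ν) (fun _ => φ) fun _ => hφ]
          simp
      _ ≤ ENNReal.ofReal (Real.exp (-(c * N ^ r))) * ENNReal.ofReal (Real.exp (K * l ^ 2)) ^ n := by
          gcongr
      _ = _ := by
          rw [← ENNReal.ofReal_pow (by positivity), ← ENNReal.ofReal_mul (by positivity),
            ← Real.exp_nat_mul]
  have hsub : {v : Fin n → ℝ | N ≤ ∑ i, v i} ⊆ (⋃ i, (fun v => v i) ⁻¹' (Ici N)) ∪ A := by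
    intro v hv
    by_cases h : ∀ i, v i ≤ N
    · exact Or.inr ⟨hv, h⟩
    · push Not at h
      obtain ⟨i, hi⟩ := h
      exact Or.inl (mem_iUnion.2 ⟨i, hi.le⟩)
  calc (Measure.pi fun _ : Fin n => ν) {v | N ≤ ∑ i, v i}
      ≤ (∑ i : Fin n, (Measure.pi fun _ : Fin n => ν) ((fun v => v i) ⁻¹' (Ici N)))
        + (Measure.pi fun _ : Fin n => ν) A :=
        (measure_mono hsub).trans ((measure_union_le _ _).trans
          (add_le_add_left (measure_iUnion_fintype_le _ _) _))
    _ ≤ n * ENNReal.ofReal (Real.exp (-(c * N ^ r)) * K) +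
        ENNReal.ofReal (Real.exp (-(c * N ^ r)) * Real.exp (n * (K * l ^ 2))) := by
        refine add_le_add ?_ hA
        have h3 : ∀ i : Fin n, (Measure.pi fun _ : Fin n => ν) ((fun v => v i) ⁻¹' (Ici N))
            ≤ ENNReal.ofReal (Real.exp (-(c * N ^ r)) * K) := fun i => by
          rw [(measurePreserving_eval (fun _ : Fin n => ν) i).measure_preimage
            measurableSet_Ici.nullMeasurableSet]
          exact htail
        refine (Finset.sum_le_sum fun i _ => h3 i).trans_eq ?_
        simp
    _ = _ := by
        rw [← ENNReal.ofReal_natCast, ← ENNReal.ofReal_mul (by positivity),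
          ← ENNReal.ofReal_add (by positivity) (by positivity)]
        congr 1; ring

/-- The law of the product of independent `μ_p` and standard Gaussian variables. -/
def prodLaw (p : ℝ) : Measure ℝ := ((muP p).prod (muP 2)).map fun z => z.1 * z.2

lemma map_neg_prodLaw {p : ℝ} (hp : 0 < p) : (prodLaw p).map (fun t => -t) = prodLaw p := by
  have := isProbabilityMeasure_muP hp
  have hm : ((muP p).prod (muP 2)).map (fun z => (z.1, -z.2)) = (muP p).prod (muP 2) := by
    have := Measure.map_prod_map (muP p) (muP 2) (measurable_id (α := ℝ)) (measurable_neg (G := ℝ))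
    rw [Measure.map_id] at this
    conv_rhs => rw [← map_neg_muP 2, this]
    rfl
  rw [prodLaw, Measure.map_map measurable_neg (by fun_prop)]
  conv_rhs => rw [← hm, Measure.map_map (by fun_prop) (by fun_prop)]
  congr 1; ext z; simp

lemma freeTail_eq_pi_prodLaw {p : ℝ} (hp : 0 < p) (n : ℕ) (u : ℝ) :
    freeTail n p u = (Measure.pi fun _ : Fin n => prodLaw p) {v | u ≤ ∑ i, v i} := by
  have := isProbabilityMeasure_muP hp
  have hS : MeasurableSet {v : Fin n → ℝ | u ≤ ∑ i, v i} :=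
    measurableSet_le measurable_const (by fun_prop)
  have hmul : Measurable fun z : ℝ × ℝ => z.1 * z.2 := by fun_prop
  have : IsProbabilityMeasure (prodLaw p) := Measure.isProbabilityMeasure_map hmul.aemeasurable
  have h := measurePreserving_arrowProdEquivProdArrow ℝ ℝ (Fin n) (fun _ => muP p) (fun _ => muP 2)
  rw [freeTail, gaussPi, ← h.measure_preimage (measurableSet_le_dotp u).nullMeasurableSet]
  have h2 : (Measure.pi fun _ : Fin n => prodLaw p)
      = (Measure.pi fun _ : Fin n => (muP p).prod (muP 2)).map (fun x i => (x i).1 * (x i).2) := by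
    exact (Measure.pi_map_pi (μ := fun _ : Fin n => (muP p).prod (muP 2))
      (f := fun _ z => z.1 * z.2) (fun _ => hmul.aemeasurable)).symm
  rw [h2, Measure.map_apply (by fun_prop) hS]
  rfl

/-- Young's inequality with the exponents `p / r` and `2 / r`. -/
lemma abs_mul_rpow_le {p : ℝ} (hp : 0 < p) (y g : ℝ) :
    |y * g| ^ (2 * p / (2 + p)) / (2 * p / (2 + p)) ≤ |y| ^ p / p + |g| ^ (2 : ℝ) / 2 := by
  set r := 2 * p / (2 + p) with hr
  have hr0 : 0 < r := by positivity
  have h1 : r / p + r / 2 = 1 := by rw [hr]; field_simp; 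
  have hc : (p / r).HolderConjugate (2 / r) := by
    rw [Real.holderConjugate_iff]
    refine ⟨?_, by rw [inv_div, inv_div]; exact h1⟩
    rw [lt_div_iff₀ hr0, one_mul]
    have : r / p < 1 := by have : 0 < r / 2 := by positivity
                           linarith
    rwa [div_lt_one hp] at this
  have h := Real.young_inequality_of_nonneg (a := |y| ^ r) (b := |g| ^ r) (by positivity)
    (by positivity) hc
  rw [← Real.rpow_mul (abs_nonneg _), ← Real.rpow_mul (abs_nonneg _), mul_div_cancel₀ _ hr0.ne',
    mul_div_cancel₀ _ hr0.ne', ← Real.mul_rpow (abs_nonneg _) (abs_nonneg _), ← abs_mul] at h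
  rw [div_le_iff₀ hr0]
  refine h.trans_eq ?_
  field_simp

lemma lintegral_moment_prodLaw_lt_top {p e : ℝ} (hp : 0 < p) (he : 0 < e) (he1 : e < 1) (s : ℝ)
    (hs : 0 ≤ s) :
    ∫⁻ t, ENNReal.ofReal (|t| ^ s *
      Real.exp ((1 - e) / (2 * p / (2 + p)) * |t| ^ (2 * p / (2 + p)))) ∂(prodLaw p) < ⊤ := by
  have := isProbabilityMeasure_muP hp
  rw [prodLaw, lintegral_map (by fun_prop) (by fun_prop)]
  have h : ∀ z : ℝ × ℝ, ENNReal.ofReal (|z.1 * z.2| ^ s *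
      Real.exp ((1 - e) / (2 * p / (2 + p)) * |z.1 * z.2| ^ (2 * p / (2 + p)))) ≤
      ENNReal.ofReal (|z.1| ^ s * Real.exp ((1 - e) * (|z.1| ^ p / p))) *
        ENNReal.ofReal (|z.2| ^ s * Real.exp ((1 - e) * (|z.2| ^ (2 : ℝ) / 2))) := by
    intro z
    rw [← ENNReal.ofReal_mul (by positivity)]
    refine ENNReal.ofReal_le_ofReal ?_
    rw [mul_mul_mul_comm, ← Real.exp_add, ← mul_add, abs_mul,
      ← Real.mul_rpow (abs_nonneg _) (abs_nonneg _), ← abs_mul, div_mul_eq_mul_div, mul_div_assoc]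
    gcongr
    exact abs_mul_rpow_le hp _ _
  refine (lintegral_mono h).trans_lt ?_
  rw [lintegral_prod_mul
    (f := fun y => ENNReal.ofReal (|y| ^ s * Real.exp ((1 - e) * (|y| ^ p / p))))
    (g := fun y => ENNReal.ofReal (|y| ^ s * Real.exp ((1 - e) * (|y| ^ (2 : ℝ) / 2))))
    (by fun_prop) (by fun_prop)]
  exact ENNReal.mul_lt_top (lintegral_moment_muP_lt_top hp he s hs)
    (lintegral_moment_muP_lt_top two_pos he s hs)

lemma exists_freeTail_le {p e : ℝ} (hp : 0 < p) (hp2 : p ≤ 2) (he : 0 < e) (he1 : e < 1) :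
    ∃ K : ℝ, 0 < K ∧ ∀ (n : ℕ) (N : ℝ), 0 < N → freeTail n p N ≤
      ENNReal.ofReal (Real.exp (-((1 - e) * (N ^ (2 * p / (2 + p)) / (2 * p / (2 + p))))) *
        (n * K + Real.exp (n * (K * (N ^ (2 * p / (2 + p) - 1)) ^ 2)))) := by
  have := isProbabilityMeasure_muP hp
  have : IsProbabilityMeasure (prodLaw p) :=
    Measure.isProbabilityMeasure_map (Measurable.aemeasurable (by fun_prop))
  have h0 := lintegral_moment_prodLaw_lt_top hp he he1 0 le_rfl
  have h2 := lintegral_moment_prodLaw_lt_top hp he he1 2 zero_le_two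
  simp only [Real.rpow_zero, one_mul, Real.rpow_ofNat, sq_abs] at h0 h2
  set r := 2 * p / (2 + p) with hr
  have hr0 : 0 < r := by positivity
  have hr1 : r ≤ 1 := by rw [hr, div_le_one (by positivity)]; linarith
  set c := (1 - e) / r with hc
  have hc0 : 0 < c := div_pos (by linarith) hr0
  obtain ⟨K, hK, hK0, hK2⟩ : ∃ K : ℝ, 0 < K ∧
      ∫⁻ t, ENNReal.ofReal (Real.exp (c * |t| ^ r)) ∂(prodLaw p) ≤ ENNReal.ofReal K ∧
      ∫⁻ t, ENNReal.ofReal (t ^ 2 * Real.exp (c * |t| ^ r)) ∂(prodLaw p) ≤ ENNReal.ofReal K := by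
    set a := ∫⁻ t, ENNReal.ofReal (Real.exp (c * |t| ^ r)) ∂(prodLaw p)
    set b := ∫⁻ t, ENNReal.ofReal (t ^ 2 * Real.exp (c * |t| ^ r)) ∂(prodLaw p)
    have hab : ENNReal.ofReal ((a + b).toReal + 1) = a + b + 1 := by
      rw [ENNReal.ofReal_add ENNReal.toReal_nonneg zero_le_one,
        ENNReal.ofReal_toReal (ENNReal.add_lt_top.2 ⟨h0, h2⟩).ne, ENNReal.ofReal_one]
    refine ⟨(a + b).toReal + 1, by positivity, ?_, ?_⟩ <;> rw [hab]
    · exact le_self_add.trans le_self_add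
    · exact le_add_self.trans le_self_add
  refine ⟨max K (K * c ^ 2), lt_max_of_lt_left hK, fun n N hN => ?_⟩
  rw [freeTail_eq_pi_prodLaw hp]
  refine (pi_le_sum_le (map_neg_prodLaw hp) hr0 hr1 hc0 hN hK.le hK0 hK2 n).trans
    (ENNReal.ofReal_le_ofReal ?_)
  rw [show c * N ^ r = (1 - e) * (N ^ r / r) by rw [hc]; ring, mul_pow, ← mul_assoc K]
  gcongr
  · exact le_max_left _ _
  · exact le_max_right _ _

lemma inv_two_le_pi_sum_nonneg {ν : Measure ℝ} [IsProbabilityMeasure ν]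
    (hneg : ν.map (fun t => -t) = ν) (n : ℕ) :
    2⁻¹ ≤ (Measure.pi fun _ : Fin n => ν) {v | 0 ≤ ∑ i, v i} := by
  set P := Measure.pi fun _ : Fin n => ν
  have hmap : P.map (fun v => -v) = P := by
    have h := Measure.pi_map_pi (μ := fun _ : Fin n => ν) (f := fun _ t => -t)
      (fun _ => measurable_neg.aemeasurable)
    simp_rw [hneg] at h
    exact h
  have hS : MeasurableSet {v : Fin n → ℝ | 0 ≤ ∑ i, v i} :=
    measurableSet_le measurable_const (by fun_prop)
  have h1 : P {v | ∑ i, v i ≤ 0} = P {v | 0 ≤ ∑ i, v i} := by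
    conv_rhs => rw [← hmap, Measure.map_apply measurable_neg hS]
    congr 1; ext v
    show _ ↔ 0 ≤ ∑ i, -v i
    rw [Finset.sum_neg_distrib, neg_nonneg]
    rfl
  have h2 : 1 ≤ P {v | 0 ≤ ∑ i, v i} + P {v | 0 ≤ ∑ i, v i} := by
    nth_rw 2 [← h1]
    rw [← measure_univ (μ := P)]
    refine le_trans (measure_mono fun v _ => ?_) (measure_union_le _ _)
    exact le_total 0 (∑ i, v i)
  by_contra! h
  refine absurd h2 (not_le.2 ?_)
  rw [← ENNReal.inv_two_add_inv_two]
  exact ENNReal.add_lt_add h h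

lemma le_pi_succ_le_sum {ν : Measure ℝ} [IsProbabilityMeasure ν] (hneg : ν.map (fun t => -t) = ν)
    (n : ℕ) (N : ℝ) :
    ν (Ici N) * 2⁻¹ ≤ (Measure.pi fun _ : Fin (n + 1) => ν) {v | N ≤ ∑ i, v i} := by
  have h := measurePreserving_piFinSuccAbove (fun _ : Fin (n + 1) => ν) 0
  calc ν (Ici N) * 2⁻¹
      ≤ (ν.prod (Measure.pi fun _ : Fin n => ν)) (Ici N ×ˢ {v | 0 ≤ ∑ i, v i}) := by
        rw [Measure.prod_prod]
        gcongr
        exact inv_two_le_pi_sum_nonneg hneg n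
    _ = (Measure.pi fun _ : Fin (n + 1) => ν)
          (MeasurableEquiv.piFinSuccAbove (fun _ => ℝ) 0 ⁻¹' (Ici N ×ˢ {v | 0 ≤ ∑ i, v i})) :=
        (h.measure_preimage (measurableSet_Ici.prod
          (measurableSet_le measurable_const (by fun_prop))).nullMeasurableSet).symm
    _ ≤ _ := by
        refine measure_mono fun v hv => ?_
        have h1 : N ≤ v 0 := hv.1
        have h2 : 0 ≤ ∑ i, Fin.removeNth 0 v i := hv.2
        show N ≤ ∑ i, v i
        rw [Fin.sum_univ_succ]
        simp only [Fin.removeNth_zero, Fin.tail] at h2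
        linarith

lemma mul_muP_Ici_le_prodLaw {p a b : ℝ} (ha : 0 ≤ a) (hb : 0 ≤ b) (hp : 0 < p) :
    muP p (Ici a) * muP 2 (Ici b) ≤ prodLaw p (Ici (a * b)) := by
  have := isProbabilityMeasure_muP hp
  rw [prodLaw, Measure.map_apply (by fun_prop) measurableSet_Ici, ← Measure.prod_prod]
  refine measure_mono fun z hz => ?_
  exact mul_le_mul hz.1 hz.2 hb (ha.trans hz.1)

lemma exists_le_freeTail {p e : ℝ} (hp : 0 < p) (hp2 : p ≤ 2) (he : 0 < e) :
    ∃ C : ℝ, 0 < C ∧ ∀ᶠ N : ℝ in atTop, ∀ n : ℕ, 0 < n →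
      ENNReal.ofReal (C * Real.exp (-((1 + e) * (N ^ (2 * p / (2 + p)) / (2 * p / (2 + p)))))) ≤
        freeTail n p N := by
  have := isProbabilityMeasure_muP hp
  have : IsProbabilityMeasure (prodLaw p) :=
    Measure.isProbabilityMeasure_map (Measurable.aemeasurable (by fun_prop))
  have hc1 := muPConst_pos hp
  have hc2 := muPConst_pos two_pos
  set δ := √(1 + e)
  have hδ2 : δ ^ 2 = 1 + e := Real.sq_sqrt (by positivity)
  have hδ1 : 1 < δ := by rw [Real.lt_sqrt zero_le_one]; linarith
  have hδ0 : 0 < δ - 1 := by linarith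
  refine ⟨muPConst p * muPConst 2 * (1 / 2), by positivity, ?_⟩
  have ha := (tendsto_rpow_atTop (show 0 < 2 / (2 + p) by positivity)).eventually_ge_atTop
    (1 / (δ - 1))
  have hb := (tendsto_rpow_atTop (show 0 < p / (2 + p) by positivity)).eventually_ge_atTop
    (1 / (δ - 1))
  filter_upwards [ha, hb, eventually_gt_atTop 0] with N ha hb hN n hn
  set a := N ^ (2 / (2 + p)) with ha'
  set b := N ^ (p / (2 + p)) with hb'
  have ha0 : 0 < a := by positivity
  have hb0 : 0 < b := by positivity
  rw [div_le_iff₀ hδ0] at ha hb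
  have hab : a * b = N := by
    rw [ha', hb', ← Real.rpow_add hN, ← add_div, div_self (by positivity), Real.rpow_one]
  have hap : a ^ p = N ^ (2 * p / (2 + p)) := by
    rw [ha', ← Real.rpow_mul hN.le]; congr 1; ring
  have hb2 : b ^ (2 : ℝ) = N ^ (2 * p / (2 + p)) := by
    rw [hb', ← Real.rpow_mul hN.le]; congr 1; ring
  obtain ⟨m, rfl⟩ := Nat.exists_eq_succ_of_ne_zero hn.ne'
  rw [freeTail_eq_pi_prodLaw hp]
  refine le_trans ?_ (le_pi_succ_le_sum (map_neg_prodLaw hp) m N)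
  rw [← hab]
  refine le_trans ?_ (mul_le_mul_left ((mul_le_mul' (le_muP_Ici hp ha0.le)
    (le_muP_Ici two_pos hb0.le)).trans (mul_muP_Ici_le_prodLaw ha0.le hb0.le hp)) _)
  rw [hab, ← ENNReal.ofReal_mul (by positivity), show (2 : ℝ≥0∞)⁻¹ = ENNReal.ofReal (1 / 2) by
    rw [one_div, ENNReal.ofReal_inv_of_pos two_pos]; norm_num, ← ENNReal.ofReal_mul (by positivity)]
  refine ENNReal.ofReal_le_ofReal ?_
  have h1 : (a + 1) ^ p ≤ (1 + e) * N ^ (2 * p / (2 + p)) := by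
    calc (a + 1) ^ p ≤ (δ * a) ^ p := by gcongr; linarith
      _ = δ ^ p * N ^ (2 * p / (2 + p)) := by rw [Real.mul_rpow (by positivity) ha0.le, hap]
      _ ≤ δ ^ (2 : ℝ) * N ^ (2 * p / (2 + p)) := by gcongr; exact hδ1.le
      _ = _ := by rw [Real.rpow_two, hδ2]
  have h2 : (b + 1) ^ (2 : ℝ) ≤ (1 + e) * N ^ (2 * p / (2 + p)) := by
    calc (b + 1) ^ (2 : ℝ) ≤ (δ * b) ^ (2 : ℝ) := by gcongr; linarith
      _ = _ := by rw [Real.mul_rpow (by positivity) hb0.le, hb2, Real.rpow_two, hδ2]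
  calc muPConst p * muPConst 2 * (1 / 2) *
        Real.exp (-((1 + e) * (N ^ (2 * p / (2 + p)) / (2 * p / (2 + p)))))
      ≤ muPConst p * muPConst 2 * (1 / 2) *
        Real.exp (-((a + 1) ^ p / p) + -((b + 1) ^ (2 : ℝ) / 2)) := by
        gcongr
        calc -((1 + e) * (N ^ (2 * p / (2 + p)) / (2 * p / (2 + p))))
            = -((1 + e) * N ^ (2 * p / (2 + p)) / p) + -((1 + e) * N ^ (2 * p / (2 + p)) / 2) := by
              field_simp; ring
          _ ≤ _ := by gcongr
    _ = _ := by rw [Real.exp_add, neg_div, neg_div]; ring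

lemma tendsto_natCast_rpow_atTop {r : ℝ} (hr : 0 < r) :
    Tendsto (fun n : ℕ => (n : ℝ) ^ r) atTop atTop :=
  (tendsto_rpow_atTop hr).comp tendsto_natCast_atTop_atTop

lemma eventually_natCast_rpow_sub_one_le {r b : ℝ} (hr : r < 1) (hb : 0 < b) :
    ∀ᶠ n : ℕ in atTop, (n : ℝ) ^ (r - 1) ≤ b := by
  have h := (tendsto_rpow_neg_atTop (show 0 < 1 - r by linarith)).comp
    (tendsto_natCast_atTop_atTop (R := ℝ))
  simp only [neg_sub] at h
  exact h.eventually_le_const hb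

lemma eventually_prefactor_le {r η K a : ℝ} (hr : 0 < r) (hr1 : r < 1) (hη : 0 < η) (hK : 0 < K)
    (ha : 0 < a) : ∀ᶠ n : ℕ in atTop,
      4 * (n * K + Real.exp (n * (K * ((n * a) ^ (r - 1)) ^ 2))) ≤ Real.exp (n ^ r * η) := by
  have h1 := ((tendsto_rpow_mul_exp_neg_mul_atTop_nhds_zero (1 / r) η hη).comp
    (tendsto_natCast_rpow_atTop hr)).eventually_le_const (show 0 < 1 / (8 * K) by positivity)
  have h2 := (tendsto_natCast_rpow_atTop hr).eventually_ge_atTop (Real.log 8 * (2 / η))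
  have h3 := eventually_natCast_rpow_sub_one_le hr1
    (show 0 < η / 2 / (K * (a ^ (r - 1)) ^ 2) by positivity)
  filter_upwards [h1, h2, h3, eventually_gt_atTop 0] with n h1 h2 h3 hn
  have hn' : (0 : ℝ) < n := by exact_mod_cast hn
  have e1 : 8 * (n * K) ≤ Real.exp (n ^ r * η) := by
    simp only [Function.comp_apply] at h1
    rw [← Real.rpow_mul hn'.le, mul_one_div_cancel hr.ne', Real.rpow_one,
      show -η * (n : ℝ) ^ r = -(n ^ r * η) by ring, Real.exp_neg,
      ← div_eq_mul_inv, div_le_div_iff₀ (Real.exp_pos _) (by positivity), one_mul] at h1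
    linarith
  have e2 : 8 ≤ Real.exp (n ^ r * (η / 2)) := by
    rw [← Real.log_le_iff_le_exp (by norm_num)]
    calc Real.log 8 = Real.log 8 * (2 / η) * (η / 2) := by field_simp
      _ ≤ _ := by gcongr
  have e3 : Real.exp (n * (K * ((n * a) ^ (r - 1)) ^ 2)) ≤ Real.exp (n ^ r * (η / 2)) := by
    refine Real.exp_le_exp.2 ?_
    rw [le_div_iff₀ (by positivity)] at h3
    calc (n : ℝ) * (K * ((n * a) ^ (r - 1)) ^ 2)
        = (n * (n : ℝ) ^ (r - 1)) * ((n : ℝ) ^ (r - 1) * (K * (a ^ (r - 1)) ^ 2)) := by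
          rw [Real.mul_rpow hn'.le ha.le]; ring
      _ = (n : ℝ) ^ r * ((n : ℝ) ^ (r - 1) * (K * (a ^ (r - 1)) ^ 2)) := by
          rw [mul_comm (n : ℝ) _, ← Real.rpow_add_one hn'.ne', sub_add_cancel]
      _ ≤ _ := by gcongr
  have e4 : 8 * Real.exp (n * (K * ((n * a) ^ (r - 1)) ^ 2)) ≤ Real.exp (n ^ r * η) := by
    calc _ ≤ Real.exp (n ^ r * (η / 2)) * Real.exp (n ^ r * (η / 2)) := by gcongr
      _ = _ := by rw [← Real.exp_add]; ring_nf
  linarith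

lemma eventually_exp_add_exp_le {r η A c C : ℝ} (hr : 0 < r) (hr1 : r < 1) (hη : 0 < η)
    (hA : 0 < A) (hc : 0 < c) (hC : 0 < C) : ∀ᶠ n : ℕ in atTop,
      4 * Real.exp (-(c * n)) + Real.exp (-(n ^ r * (A + η))) ≤
        C * Real.exp (-(n ^ r * (A + η / 2))) := by
  have h1 := ((tendsto_natCast_rpow_atTop hr).eventually_ge_atTop (-Real.log (C / 2) * (2 / η)))
  have h2 := eventually_natCast_rpow_sub_one_le hr1 (show 0 < c / 2 / (A + η / 2) by positivity)
  have h3 := (tendsto_natCast_atTop_atTop (R := ℝ)).eventually_ge_atTop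
    (-Real.log (C / 8) * (2 / c))
  filter_upwards [h1, h2, h3, eventually_gt_atTop 0] with n h1 h2 h3 hn
  have hn' : (0 : ℝ) < n := by exact_mod_cast hn
  have e1 : Real.exp (-(n ^ r * (A + η))) ≤ C / 2 * Real.exp (-(n ^ r * (A + η / 2))) := by
    rw [show C / 2 = Real.exp (Real.log (C / 2)) from (Real.exp_log (by positivity)).symm,
      ← Real.exp_add]
    gcongr
    have : -Real.log (C / 2) ≤ n ^ r * (η / 2) := by
      calc -Real.log (C / 2) = -Real.log (C / 2) * (2 / η) * (η / 2) := by field_simp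
        _ ≤ _ := by gcongr
    linarith
  have e2 : Real.exp (-(c * n)) ≤ C / 8 * Real.exp (-(n ^ r * (A + η / 2))) := by
    rw [show C / 8 = Real.exp (Real.log (C / 8)) from (Real.exp_log (by positivity)).symm,
      ← Real.exp_add]
    gcongr
    have h4 : -Real.log (C / 8) ≤ n * (c / 2) := by
      calc -Real.log (C / 8) = -Real.log (C / 8) * (2 / c) * (c / 2) := by field_simp
        _ ≤ _ := by gcongr
    have h5 : (n : ℝ) ^ r * (A + η / 2) ≤ n * (c / 2) := by
      rw [le_div_iff₀ (by positivity)] at h2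
      calc (n : ℝ) ^ r * (A + η / 2) = n * ((n : ℝ) ^ (r - 1) * (A + η / 2)) := by
            conv_lhs => rw [← sub_add_cancel r 1, Real.rpow_add_one hn'.ne']
            ring
        _ ≤ _ := by gcongr
    linarith
  linarith

lemma natCast_mul_rpow_eq {p δ w : ℝ} (n : ℕ) (hp : 0 < p) (hδ : 0 < δ) (hw : 0 < w) :
    (n * (δ ^ (1 / p + 1 / 2) * w)) ^ (2 * p / (2 + p)) / (2 * p / (2 + p)) =
      δ * (n ^ (2 * p / (2 + p)) * (w ^ (2 * p / (2 + p)) / (2 * p / (2 + p)))) := by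
  rw [Real.mul_rpow (by positivity) (by positivity), Real.mul_rpow (by positivity) hw.le,
    ← Real.rpow_mul hδ.le, show (1 / p + 1 / 2) * (2 * p / (2 + p)) = 1 by field_simp,
    Real.rpow_one]
  ring

lemma eventually_le_ballTail {p w η : ℝ} (hp : 0 < p) (hp2 : p < 2) (hw : 0 < w) (hη : 0 < η) :
    ∀ᶠ n : ℕ in atTop, ∀ μ : Measure (Fin n → ℝ), IsProbabilityMeasure (uniformLpBall n p) →
      IsUniformSphere μ →
      ENNReal.ofReal (Real.exp (-(n ^ (2 * p / (2 + p)) *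
        (w ^ (2 * p / (2 + p)) / (2 * p / (2 + p)) + η)))) ≤
      ballTail p μ (n ^ (1 / 2 - 1 / p) * w) := by
  set r := 2 * p / (2 + p) with hr
  have hr0 : 0 < r := by positivity
  have hr1 : r < 1 := by rw [hr, div_lt_one (by positivity)]; linarith
  set A := w ^ r / r with hA
  have hA0 : 0 < A := by positivity
  set ε := min (1 / 2) (η / (6 * A)) with hε
  have hε0 : 0 < ε := by positivity
  have hε1 : ε ≤ 1 / 2 := min_le_left _ _
  have hε2 : ε * A ≤ η / 6 := by
    calc ε * A ≤ η / (6 * A) * A := by gcongr; exact min_le_right _ _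
      _ = _ := by field_simp
  obtain ⟨c, hc, H⟩ := exists_freeTail_le_ballTail hp hε0 (show ε < 1 by linarith)
  obtain ⟨C, hC, H2⟩ := exists_le_freeTail hp hp2.le hε0
  set w' := (1 + ε) ^ (1 / p + 1 / 2) * w with hw'
  have hw0 : 0 < w' := by positivity
  have H3 := (tendsto_natCast_atTop_atTop.atTop_mul_const hw0).eventually H2
  filter_upwards [H3, eventually_exp_add_exp_le hr0 hr1 hη hA0 hc hC, eventually_gt_atTop 0]
    with n h3 h4 hn μ hU hμ
  have h5 := (h3 n hn).trans (H n μ w hn hU hμ hw)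
  rw [natCast_mul_rpow_eq n hp (by positivity) hw, ← hr, ← hA] at h5
  refine (ENNReal.add_le_add_iff_left (a := ENNReal.ofReal (4 * Real.exp (-(c * n))))
    ENNReal.ofReal_ne_top).1 (le_trans ?_ h5)
  rw [← ENNReal.ofReal_add (by positivity) (by positivity)]
  refine ENNReal.ofReal_le_ofReal (h4.trans ?_)
  refine mul_le_mul_of_nonneg_left (Real.exp_le_exp.2 (neg_le_neg ?_)) hC.le
  have h6 : (1 + ε) * ((1 + ε) * A) ≤ A + η / 2 := by nlinarith
  calc (1 + ε) * ((1 + ε) * ((n : ℝ) ^ r * A)) = (n : ℝ) ^ r * ((1 + ε) * ((1 + ε) * A)) := by ring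
    _ ≤ _ := by gcongr

lemma eventually_ballTail_le {p w η : ℝ} (hp : 0 < p) (hp2 : p < 2) (hw : 0 < w) (hη : 0 < η) :
    ∀ᶠ n : ℕ in atTop, ∀ μ : Measure (Fin n → ℝ), IsProbabilityMeasure (uniformLpBall n p) →
      IsUniformSphere μ →
      ballTail p μ (n ^ (1 / 2 - 1 / p) * w) ≤
      ENNReal.ofReal (Real.exp (-(n ^ (2 * p / (2 + p)) *
        (w ^ (2 * p / (2 + p)) / (2 * p / (2 + p)) - η)))) := by
  set r := 2 * p / (2 + p) with hr
  have hr0 : 0 < r := by positivity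
  have hr1 : r < 1 := by rw [hr, div_lt_one (by positivity)]; linarith
  set A := w ^ r / r with hA
  have hA0 : 0 < A := by positivity
  set ε := min (1 / 2) (η / (4 * A)) with hε
  have hε0 : 0 < ε := by positivity
  have hε1 : ε ≤ 1 / 2 := min_le_left _ _
  have hε2 : ε * A ≤ η / 4 := by
    calc ε * A ≤ η / (4 * A) * A := by gcongr; exact min_le_right _ _
      _ = _ := by field_simp
  obtain ⟨K, hK, H2⟩ := exists_freeTail_le hp hp2.le hε0 (show ε < 1 by linarith)
  have hδ : 0 < 1 - ε := by linarith
  set w' := (1 - ε) ^ (1 / p + 1 / 2) * w with hw'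
  have hw0 : 0 < w' := by positivity
  filter_upwards [exists_ballTail_le_freeTail hp hε0 (show ε < 1 by linarith),
    eventually_prefactor_le hr0 hr1 (half_pos hη) hK hw0, eventually_gt_atTop 0]
    with n h3 h4 hn μ hU hμ
  have hn' : (0 : ℝ) < n := by exact_mod_cast hn
  refine (h3 μ w hU hμ hw).trans ?_
  have h5 := H2 n (n * w') (by positivity)
  rw [natCast_mul_rpow_eq n hp hδ hw, ← hr, ← hA] at h5
  refine (mul_le_mul_right h5 4).trans ?_
  rw [← ENNReal.ofReal_ofNat, ← ENNReal.ofReal_mul (by positivity)]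
  refine ENNReal.ofReal_le_ofReal ?_
  rw [mul_left_comm]
  refine (mul_le_mul_of_nonneg_left h4 (Real.exp_pos _).le).trans ?_
  rw [← Real.exp_add]
  gcongr
  have h6 : A - η / 2 ≤ (1 - ε) * ((1 - ε) * A) := by nlinarith [mul_nonneg (sq_nonneg ε) hA0.le]
  have h7 : (n : ℝ) ^ r * (A - η / 2) ≤ (n : ℝ) ^ r * ((1 - ε) * ((1 - ε) * A)) := by gcongr
  linarith

lemma coe_le_inv_mul_log_of_exp_le {s a : ℝ} {x : ℝ≥0∞} (hs : 0 < s)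
    (h : ENNReal.ofReal (Real.exp (s * a)) ≤ x) :
    (a : EReal) ≤ ((s⁻¹ : ℝ) : EReal) * ENNReal.log x := by
  have h1 := ENNReal.log_monotone h
  rw [ENNReal.log_ofReal_of_pos (Real.exp_pos _), Real.log_exp] at h1
  calc (a : EReal) = ((s⁻¹ : ℝ) : EReal) * ((s * a : ℝ) : EReal) := by
        rw [← EReal.coe_mul, inv_mul_cancel_left₀ hs.ne']
    _ ≤ _ := mul_le_mul_of_nonneg_left h1 (by exact_mod_cast (inv_pos.2 hs).le)

lemma inv_mul_log_le_coe_of_le_exp {s a : ℝ} {x : ℝ≥0∞} (hs : 0 < s)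
    (h : x ≤ ENNReal.ofReal (Real.exp (s * a))) :
    ((s⁻¹ : ℝ) : EReal) * ENNReal.log x ≤ a := by
  have h1 := ENNReal.log_monotone h
  rw [ENNReal.log_ofReal_of_pos (Real.exp_pos _), Real.log_exp] at h1
  calc _ ≤ ((s⁻¹ : ℝ) : EReal) * ((s * a : ℝ) : EReal) :=
        mul_le_mul_of_nonneg_left h1 (by exact_mod_cast (inv_pos.2 hs).le)
    _ = (a : EReal) := by rw [← EReal.coe_mul, inv_mul_cancel_left₀ hs.ne']

section Tails

variable {Ω : Type*} [MeasurableSpace Ω] {P : Measure Ω}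
  {ξ : ℕ → Ω → ℝ} {s : ℕ → ℝ} {J : ℝ → ℝ}

lemma eventually_exp_le_measure_Ico (hs : Tendsto s atTop atTop) (hJm : StrictMonoOn J (Ici 0))
    (hlow : ∀ w, 0 < w → ∀ η, 0 < η → ∀ᶠ n in atTop,
      ENNReal.ofReal (Real.exp (-(s n * (J w + η)))) ≤ P {ω | w ≤ ξ n ω})
    (hup : ∀ w, 0 < w → ∀ η, 0 < η → ∀ᶠ n in atTop,
      P {ω | w ≤ ξ n ω} ≤ ENNReal.ofReal (Real.exp (-(s n * (J w - η)))))
    {w z η : ℝ} (hw : 0 < w) (hwz : w < z) (hη : 0 < η) : ∀ᶠ n in atTop,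
      ENNReal.ofReal (Real.exp (s n * (-J w - η))) ≤ P {ω | w ≤ ξ n ω ∧ ξ n ω < z} := by
  have hδ : 0 < J z - J w := sub_pos.2 (hJm hw.le (hw.trans hwz).le hwz)
  set κ := min (η / 2) ((J z - J w) / 4) with hκ
  have hκ0 : 0 < κ := by positivity
  have hκ1 : κ ≤ η / 2 := min_le_left _ _
  have hκ2 : κ ≤ (J z - J w) / 4 := min_le_right _ _
  filter_upwards [hlow w hw κ hκ0, hup z (hw.trans hwz) κ hκ0,
    hs.eventually_ge_atTop (Real.log 2 / κ), hs.eventually_gt_atTop 0] with n h1 h2 h3 h4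
  have hsub : {ω | w ≤ ξ n ω} ⊆ {ω | z ≤ ξ n ω} ∪ {ω | w ≤ ξ n ω ∧ ξ n ω < z} := by
    intro ω hω
    rcases le_or_gt z (ξ n ω) with h | h
    · exact Or.inl h
    · exact Or.inr ⟨hω, h⟩
  have h5 := h1.trans ((measure_mono hsub).trans ((measure_union_le _ _).trans
    (add_le_add_left h2 _)))
  refine (ENNReal.add_le_add_iff_left ENNReal.ofReal_ne_top).1 (le_trans ?_ h5)
  rw [← ENNReal.ofReal_add (by positivity) (by positivity)]
  refine ENNReal.ofReal_le_ofReal ?_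
  set q := Real.exp (-(s n * κ)) with hq
  have hq0 : 0 < q := Real.exp_pos _
  have hq2 : q ≤ 1 / 2 := by
    rw [hq, Real.exp_neg, inv_eq_one_div]
    refine one_div_le_one_div_of_le two_pos ?_
    rw [← Real.log_le_iff_le_exp two_pos]
    rwa [div_le_iff₀ hκ0] at h3
  set E := Real.exp (-(s n * J w)) with hE
  have hE0 : 0 < E := Real.exp_pos _
  have e1 : Real.exp (-(s n * (J z - κ))) ≤ E * q ^ 3 := by
    rw [hE, hq, ← Real.exp_nat_mul, ← Real.exp_add]
    refine Real.exp_le_exp.2 ?_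
    push_cast
    nlinarith
  have e2 : Real.exp (s n * (-J w - η)) ≤ E * q ^ 2 := by
    rw [hE, hq, ← Real.exp_nat_mul, ← Real.exp_add]
    refine Real.exp_le_exp.2 ?_
    push_cast
    nlinarith
  have e3 : Real.exp (-(s n * (J w + κ))) = E * q := by
    rw [hE, hq, ← Real.exp_add]; ring_nf
  rw [e3]
  have e4 : q ^ 3 + q ^ 2 ≤ q := by nlinarith [mul_pos hq0 hq0]
  nlinarith

/-- A large deviation principle follows from logarithmic tail asymptotics of a symmetric sequence,
provided that the rate increases strictly away from the origin. -/
lemma isLDP_of_tails [IsProbabilityMeasure P] (hs : Tendsto s atTop atTop) (hJc : Continuous J)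
    (hJe : ∀ x, J (-x) = J x)
    (hJm : StrictMonoOn J (Ici 0)) (hJs : ∀ a, 0 < a → ∃ w, 0 < w ∧ J w = a)
    (hlow : ∀ w, 0 < w → ∀ η, 0 < η → ∀ᶠ n in atTop,
      ENNReal.ofReal (Real.exp (-(s n * (J w + η)))) ≤ P {ω | w ≤ ξ n ω})
    (hup : ∀ w, 0 < w → ∀ η, 0 < η → ∀ᶠ n in atTop,
      P {ω | w ≤ ξ n ω} ≤ ENNReal.ofReal (Real.exp (-(s n * (J w - η)))))
    (hsymm : ∀ᶠ n in atTop, ∀ w, P {ω | w ≤ -ξ n ω} = P {ω | w ≤ ξ n ω}) :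
    IsLDP P ξ s (fun x => (J x : EReal)) := by
  have hJabs : ∀ x, J |x| = J x := fun x => by
    rcases abs_choice x with h | h <;> rw [h]
    exact hJe x
  refine ⟨(continuous_coe_real_ereal.comp hJc).lowerSemicontinuous, fun Γ _ => ⟨?_, ?_⟩⟩
  · rw [EReal.neg_le]
    refine le_iInf₂ fun x hx => ?_
    rw [EReal.neg_le, ← EReal.coe_neg]
    refine EReal.ge_of_forall_gt_iff_ge.1 fun c hc => ?_
    have hc' : c < -J x := by exact_mod_cast hc
    have hopen : IsOpen (interior Γ ∩ {y | c < -J y}) :=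
      isOpen_interior.inter (isOpen_lt continuous_const hJc.neg)
    obtain ⟨y, ⟨hyΓ, hyc⟩, hy0⟩ := (dense_compl_singleton (0 : ℝ)).inter_open_nonempty _ hopen
      ⟨x, hx, hc'⟩
    have hyc : c < -J y := hyc
    have hη : 0 < -J y - c := by linarith
    obtain ⟨δ, hδ, hball⟩ := Metric.isOpen_iff.1 isOpen_interior y hyΓ
    have hw : 0 < |y| := abs_pos.2 hy0
    refine le_liminf_of_le (h := ?_)
    filter_upwards [hs.eventually_gt_atTop 0,
      eventually_exp_le_measure_Ico hs hJm hlow hup hw (show |y| < |y| + δ by linarith) hη,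
      eventually_exp_le_measure_Ico (ξ := fun n ω => -ξ n ω) hs hJm
        (fun w hw η hη => by
          filter_upwards [hlow w hw η hη, hsymm] with n h1 h2
          rwa [h2])
        (fun w hw η hη => by
          filter_upwards [hup w hw η hη, hsymm] with n h1 h2
          rwa [h2]) hw (show |y| < |y| + δ by linarith) hη] with n hn h1 h2
    refine coe_le_inv_mul_log_of_exp_le hn ?_
    rw [hJabs, sub_sub_cancel] at h1 h2
    rcases lt_or_gt_of_ne hy0 with hy | hy
    · refine h2.trans (measure_mono fun ω hω => hball ?_)
      have hω : |y| ≤ -ξ n ω ∧ -ξ n ω < |y| + δ := hω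
      rw [abs_of_neg hy] at hω
      rw [Metric.mem_ball, Real.dist_eq, abs_lt]
      constructor <;> linarith
    · refine h1.trans (measure_mono fun ω hω => hball ?_)
      have hω : |y| ≤ ξ n ω ∧ ξ n ω < |y| + δ := hω
      rw [abs_of_pos hy] at hω
      rw [Metric.mem_ball, Real.dist_eq, abs_lt]
      constructor <;> linarith
  · refine EReal.le_of_forall_lt_iff_le.1 fun c hc => ?_
    obtain ⟨b, hb, hbc⟩ := EReal.lt_iff_exists_real_btwn.1 hc
    have hbc : b < c := by exact_mod_cast hbc
    refine limsup_le_of_le (h := ?_)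
    rcases le_or_gt 0 c with hc0 | hc0
    · filter_upwards [hs.eventually_gt_atTop 0] with n hn
      refine inv_mul_log_le_coe_of_le_exp hn (prob_le_one.trans ?_)
      rw [ENNReal.one_le_ofReal]
      exact Real.one_le_exp (by positivity)
    · obtain ⟨w, hw, hJw⟩ := hJs (-b) (by linarith)
      have hsub : ∀ x ∈ closure Γ, w ≤ |x| := by
        intro x hx
        have h1 : ((-b : ℝ) : EReal) < J x := by
          rw [EReal.coe_neg]
          exact (EReal.neg_lt_comm.1 hb).trans_le (iInf₂_le x hx)
        have h2 : J w < J |x| := by rw [hJw, hJabs]; exact_mod_cast h1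
        exact ((hJm.lt_iff_lt hw.le (abs_nonneg x)).1 h2).le
      have hη : 0 < (c - b) / 2 := by linarith
      filter_upwards [hs.eventually_gt_atTop 0, hup w hw _ hη, hsymm,
        hs.eventually_ge_atTop (Real.log 2 / ((c - b) / 2))] with n hn h1 h2 h3
      refine inv_mul_log_le_coe_of_le_exp hn ?_
      calc P {ω | ξ n ω ∈ closure Γ}
          ≤ P ({ω | w ≤ ξ n ω} ∪ {ω | w ≤ -ξ n ω}) :=
            measure_mono fun ω hω => le_abs.1 (hsub _ hω)
        _ ≤ P {ω | w ≤ ξ n ω} + P {ω | w ≤ -ξ n ω} := measure_union_le _ _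
        _ ≤ _ := by
          rw [h2]
          refine (add_le_add h1 h1).trans ?_
          rw [← ENNReal.ofReal_add (by positivity) (by positivity)]
          refine ENNReal.ofReal_le_ofReal ?_
          rw [← two_mul]
          nth_rewrite 1 [← Real.exp_log two_pos]
          rw [← Real.exp_add, hJw]
          refine Real.exp_le_exp.2 ?_
          rw [div_le_iff₀ hη] at h3
          linarith

end Tails

section Rate

variable {J : ℝ → ℝ}

lemma hasCompactSublevels_coe (hJc : Continuous J) (hJe : ∀ x, J (-x) = J x)
    (hJm : StrictMonoOn J (Ici 0)) (hJs : ∀ a, 0 < a → ∃ w, 0 < w ∧ J w = a) :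
    HasCompactSublevels (fun x => (J x : EReal)) := by
  intro c
  obtain ⟨w, hw, hJw⟩ := hJs (max c 1) (by positivity)
  refine (isCompact_Icc (a := -w) (b := w)).of_isClosed_subset
    (isClosed_le (continuous_coe_real_ereal.comp hJc) continuous_const) fun x hx => ?_
  have hx : (J x : EReal) ≤ c := hx
  have h1 : J |x| ≤ J w := by
    have h2 : J |x| = J x := by
      rcases abs_choice x with h | h <;> rw [h]
      exact hJe x
    rw [h2, hJw]
    exact le_max_of_le_left (by exact_mod_cast hx)
  exact abs_le.1 ((hJm.le_iff_le (abs_nonneg x) hw.le).1 h1)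

lemma quasiconvexRate_coe (hJe : ∀ x, J (-x) = J x) (hJm : MonotoneOn J (Ici 0)) :
    QuasiconvexRate (fun x => (J x : EReal)) := by
  have hJabs : ∀ x, J |x| = J x := fun x => by
    rcases abs_choice x with h | h <;> rw [h]
    exact hJe x
  intro c
  refine OrdConnected.convex ⟨fun x hx y hy z hz => ?_⟩
  have hx : (J x : EReal) ≤ c := hx
  have hy : (J y : EReal) ≤ c := hy
  show (J z : EReal) ≤ c
  rcases le_max_iff.1 (abs_le_max_abs_abs hz.1 hz.2) with h | h
  · refine le_trans ?_ hx
    rw [← hJabs z, ← hJabs x]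
    exact_mod_cast hJm (abs_nonneg z) (abs_nonneg x) h
  · refine le_trans ?_ hy
    rw [← hJabs z, ← hJabs y]
    exact_mod_cast hJm (abs_nonneg z) (abs_nonneg y) h

end Rate

lemma continuous_abs_rpow_div {r : ℝ} (hr : 0 < r) : Continuous fun x : ℝ => |x| ^ r / r :=
  (continuous_abs.rpow_const fun _ => Or.inr hr.le).div_const r

lemma strictMonoOn_abs_rpow_div {r : ℝ} (hr : 0 < r) :
    StrictMonoOn (fun x : ℝ => |x| ^ r / r) (Ici 0) := by
  intro x hx y hy hxy
  show |x| ^ r / r < |y| ^ r / r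
  rw [abs_of_nonneg hx, abs_of_nonneg hy]
  exact div_lt_div_of_pos_right (Real.rpow_lt_rpow hx hxy hr) hr

lemma exists_abs_rpow_div_eq {r a : ℝ} (hr : 0 < r) (ha : 0 < a) :
    ∃ w : ℝ, 0 < w ∧ |w| ^ r / r = a := by
  refine ⟨(r * a) ^ r⁻¹, by positivity, ?_⟩
  rw [abs_of_pos (by positivity), Real.rpow_inv_rpow (by positivity) hr.ne',
    mul_div_cancel_left₀ _ hr.ne']

lemma map_neg_eq_of_isUniformSphere {n : ℕ} {μ : Measure (Fin n → ℝ)} (hμ : IsUniformSphere μ) :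
    Measure.map (fun x => -x) μ = μ := by
  have h := hμ.2.2 ⟨-1, by simp [Matrix.mem_orthogonalGroup_iff]⟩
  simpa [Matrix.neg_mulVec] using h

lemma measure_le_dotp_eq_ballTail {Ω : Type*} [MeasurableSpace Ω] {P : Measure Ω}
    [IsProbabilityMeasure P] {n : ℕ} {p : ℝ} {X Θ : Ω → Fin n → ℝ} (hX : Measurable X)
    (hΘ : Measurable Θ) (hlaw : Measure.map X P = uniformLpBall n p) (hind : IndepFun X Θ P)
    (hn : 0 < n) (w : ℝ) :
    P {ω | w ≤ (n : ℝ) ^ (1 / p - 1 / 2) * dotp (X ω) (Θ ω)} =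
      ballTail p (Measure.map Θ P) (n ^ (1 / 2 - 1 / p) * w) := by
  have hn' : (0 : ℝ) < n := by exact_mod_cast hn
  rw [ballTail, ← hlaw, ← (indepFun_iff_map_prod_eq_prod_map_map hX.aemeasurable
    hΘ.aemeasurable).1 hind, Measure.map_apply (hX.prodMk hΘ)
    (measurableSet_le measurable_const (measurable_fst.dotp measurable_snd))]
  congr 1
  ext ω
  show w ≤ (n : ℝ) ^ (1 / p - 1 / 2) * dotp (X ω) (Θ ω) ↔
    (n : ℝ) ^ (1 / 2 - 1 / p) * w ≤ dotp (X ω) (Θ ω)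
  rw [show (1 / 2 - 1 / p : ℝ) = -(1 / p - 1 / 2) by ring, Real.rpow_neg hn'.le,
    inv_mul_le_iff₀ (by positivity)]

/-- Annealed LDP for `p ∈ [1,2)`, with speed `n^{r_p}` and rate `|w|^{r_p}/r_p`. -/
theorem statement1
    (p : ℝ) (hp1 : 1 ≤ p) (hp2 : p < 2)
    {Ω : Type*} [MeasurableSpace Ω] (P : Measure Ω) [IsProbabilityMeasure P]
    (X Θ : (n : ℕ) → Ω → (Fin n → ℝ))
    (hXmeas : ∀ n, Measurable (X n)) (hΘmeas : ∀ n, Measurable (Θ n))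
    (hX : ∀ n, 0 < n → Measure.map (X n) P = uniformLpBall n p)
    (hΘ : ∀ n, 0 < n → IsUniformSphere (Measure.map (Θ n) P))
    (hIndep : ∀ n, IndepFun (X n) (Θ n) P) :
    IsLDP P (fun n ω => (n : ℝ) ^ (1/p - 1/2 : ℝ) * dotp (X n ω) (Θ n ω))
      (fun n => (n : ℝ) ^ (2*p/(2+p)))
      (fun w => ((|w| ^ (2*p/(2+p)) / (2*p/(2+p)) : ℝ) : EReal))
    ∧ HasCompactSublevels (fun w => ((|w| ^ (2*p/(2+p)) / (2*p/(2+p)) : ℝ) : EReal))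
    ∧ QuasiconvexRate (fun w => ((|w| ^ (2*p/(2+p)) / (2*p/(2+p)) : ℝ) : EReal))
    ∧ SymmetricRate (fun w => ((|w| ^ (2*p/(2+p)) / (2*p/(2+p)) : ℝ) : EReal)) := by
  have hp : 0 < p := by linarith
  have hr : 0 < 2 * p / (2 + p) := by positivity
  have hJe : ∀ x : ℝ, |-x| ^ (2 * p / (2 + p)) / (2 * p / (2 + p)) =
      |x| ^ (2 * p / (2 + p)) / (2 * p / (2 + p)) := fun x => by rw [abs_neg]
  have hJc := continuous_abs_rpow_div hr
  have hJm := strictMonoOn_abs_rpow_div hr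
  have hJs := fun a (ha : 0 < a) => exists_abs_rpow_div_eq hr ha
  have hprob : ∀ n, 0 < n → IsProbabilityMeasure (uniformLpBall n p) := fun n hn =>
    hX n hn ▸ Measure.isProbabilityMeasure_map (hXmeas n).aemeasurable
  have htail := fun n (hn : 0 < n) =>
    measure_le_dotp_eq_ballTail (hXmeas n) (hΘmeas n) (hX n hn) (hIndep n) hn
  refine ⟨isLDP_of_tails (tendsto_natCast_rpow_atTop hr) hJc hJe hJm hJs ?_ ?_ ?_,
    hasCompactSublevels_coe hJc hJe hJm hJs, quasiconvexRate_coe hJe hJm.monotoneOn,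
    fun w => by simp only [hJe]⟩
  · intro w hw η hη
    filter_upwards [eventually_le_ballTail hp hp2 hw hη, eventually_gt_atTop 0] with n h hn
    rw [htail n hn, abs_of_pos hw]
    exact h _ (hprob n hn) (hΘ n hn)
  · intro w hw η hη
    filter_upwards [eventually_ballTail_le hp hp2 hw hη, eventually_gt_atTop 0] with n h hn
    rw [htail n hn, abs_of_pos hw]
    exact h _ (hprob n hn) (hΘ n hn)
  · filter_upwards [eventually_gt_atTop 0] with n hn w
    have hneg : Measure.map (fun ω => -Θ n ω) P = Measure.map (Θ n) P := by
      rw [← map_neg_eq_of_isUniformSphere (hΘ n hn), Measure.map_map measurable_neg (hΘmeas n)]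
      rfl
    have h := measure_le_dotp_eq_ballTail (hXmeas n) (hΘmeas n).neg (hX n hn)
      ((hIndep n).comp measurable_id measurable_neg) hn w
    rw [htail n hn, ← hneg]
    refine Eq.trans ?_ h
    congr 1
    ext ω
    show w ≤ -((n : ℝ) ^ (1 / p - 1 / 2) * dotp (X n ω) (Θ n ω)) ↔
      w ≤ (n : ℝ) ^ (1 / p - 1 / 2) * dotp (X n ω) (-Θ n ω)
    simp [dotp]
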